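/- arXiv:1311.5121 — 3 statements merged into one kernel-verified Lean document; each statement's English description precedes it below -/
import Mathlib

section
/- Let p : ℝⁿ → [1,∞) be locally log-Hölder continuous with constant C and with p⁺ := sup p < ∞. Then for every m > 0 there exists c > 0 depending only on m, C and p⁺ such that for every cube Q ⊂ ℝⁿ with side length ℓ(Q) ≤ 1, every a ≥ 0, and every continuously differentiable function u : ℝⁿ → ℝ satisfying a + ⨍_Q |∇u| dy ≤ max{1, |Q|^{−m}}, one has ∫_Q φ_a(x, |u(x) − ⟨u⟩_Q| / ℓ(Q)) dx ≤ c ∫_Q φ_a(x, |∇u(x)|) dx + c |Q|^m, where ⟨u⟩_Q := ⨍_Q u dx. -/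
open MeasureTheory Set

noncomputable section

/-- The axis-parallel cube in `ℝⁿ` with lower corner `z` and side length `ℓ`. -/
def cube (n : ℕ) (z : Fin n → ℝ) (ℓ : ℝ) : Set (Fin n → ℝ) :=
  Set.Icc z (fun i => z i + ℓ)

/-- `p` is locally log-Hölder continuous with constant `C`. -/
def LogHolder (n : ℕ) (C : ℝ) (p : (Fin n → ℝ) → ℝ) : Prop :=
  ∀ x y : Fin n → ℝ, x ≠ y →
    |p x - p y| ≤ C / Real.log (Real.exp 1 + 1 / ‖x - y‖)

/-- The shifted function `φ_a(x,t) = ∫₀ᵗ p(x) (a+τ)^(p(x)-2) τ dτ` associated to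
`φ(x,t) = t^(p x)`. -/
def phiShift (n : ℕ) (p : (Fin n → ℝ) → ℝ) (a : ℝ) (x : Fin n → ℝ) (t : ℝ) : ℝ :=
  ∫ τ in (0:ℝ)..t, p x * (a + τ) ^ (p x - 2) * τ

/-- The shifted power `t ↦ ∫₀ᵗ q (a+τ)^(q-2) τ dτ` with a constant exponent `q`. -/
def shiftedPower (a q t : ℝ) : ℝ :=
  ∫ τ in (0:ℝ)..t, q * (a + τ) ^ (q - 2) * τ

lemma monotoneOn_shiftedPower_density {a q : ℝ} (ha : 0 ≤ a) (hq : 1 ≤ q) :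
    MonotoneOn (fun τ : ℝ => q * (a + τ) ^ (q - 2) * τ) (Ici 0) := by
  intro s hs t ht hst
  simp only [mem_Ici] at hs ht
  rcases hs.eq_or_lt with rfl | hs0
  · simp only [mul_zero]; positivity
  have ht0 : 0 < t := hs0.trans_le hst
  have key : ∀ r : ℝ, 0 < r → q * (a + r) ^ (q - 2) * r
      = q * ((a + r) ^ (q - 1) * (r / (a + r))) := by
    intro r hr
    have h : (a + r) ^ (q - 1) = (a + r) ^ (q - 2) * (a + r) := by
      rw [show q - 1 = (q - 2) + 1 by ring, Real.rpow_add_one (by positivity)]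
    rw [h]; field_simp
  simp only [key s hs0, key t ht0]
  have h1 : (a + s) ^ (q - 1) ≤ (a + t) ^ (q - 1) :=
    Real.rpow_le_rpow (by positivity) (by linarith) (by linarith)
  have h2 : s / (a + s) ≤ t / (a + t) := by
    rw [div_le_div_iff₀ (by positivity) (by positivity)]; nlinarith
  gcongr

lemma intervalIntegrable_shiftedPower_density {a q s t : ℝ} (ha : 0 ≤ a) (hq : 1 ≤ q)
    (hs : 0 ≤ s) (ht : 0 ≤ t) :
    IntervalIntegrable (fun τ : ℝ => q * (a + τ) ^ (q - 2) * τ) volume s t := by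
  refine ((monotoneOn_shiftedPower_density ha hq).mono ?_).intervalIntegrable
  intro x hx
  exact (le_min hs ht).trans hx.1

lemma shiftedPower_mono {a q : ℝ} (ha : 0 ≤ a) (hq : 1 ≤ q) :
    MonotoneOn (shiftedPower a q) (Ici 0) := by
  intro s hs t ht hst
  simp only [mem_Ici] at hs ht
  refine intervalIntegral.integral_mono_interval le_rfl hs hst ?_
    (intervalIntegrable_shiftedPower_density ha hq le_rfl ht)
  refine (ae_restrict_iff' measurableSet_Ioc).2 (.of_forall fun τ hτ => ?_)
  have := hτ.1
  simp only [Pi.zero_apply]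
  positivity

lemma shiftedPower_nonneg {a q t : ℝ} (ha : 0 ≤ a) (hq : 1 ≤ q) (ht : 0 ≤ t) :
    0 ≤ shiftedPower a q t := by
  simpa [shiftedPower] using shiftedPower_mono ha hq (mem_Ici.2 le_rfl) (mem_Ici.2 ht) ht

lemma shiftedPower_le {a q t : ℝ} (ha : 0 ≤ a) (hq : 1 ≤ q) (ht : 0 ≤ t) :
    shiftedPower a q t ≤ q * ((a + t) ^ (q - 2) * t ^ 2) := by
  have h := intervalIntegral.integral_mono_on (μ := volume) ht
    (intervalIntegrable_shiftedPower_density ha hq le_rfl ht)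
    (intervalIntegrable_const (c := q * (a + t) ^ (q - 2) * t))
    (fun τ hτ => monotoneOn_shiftedPower_density ha hq (mem_Ici.2 hτ.1) (mem_Ici.2 ht) hτ.2)
  refine h.trans_eq ?_
  rw [intervalIntegral.integral_const, smul_eq_mul]; ring

lemma le_shiftedPower {a q P t : ℝ} (ha : 0 ≤ a) (hq : 1 ≤ q) (hP : q ≤ P) (ht : 0 ≤ t) :
    (a + t) ^ (q - 2) * t ^ 2 ≤ 4 * 2 ^ P * shiftedPower a q t := by
  rcases ht.eq_or_lt with rfl | ht0
  · simp [shiftedPower]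
  have h1 : t / 2 * (q * (a + t / 2) ^ (q - 2) * (t / 2)) ≤ shiftedPower a q t := by
    have hi1 := intervalIntegrable_shiftedPower_density (s := 0) (t := t / 2) ha hq le_rfl
      (by positivity)
    have hi2 := intervalIntegrable_shiftedPower_density (s := t / 2) (t := t) ha hq
      (by positivity) ht
    have h := intervalIntegral.integral_mono_on (μ := volume) (a := t / 2) (b := t)
      (by linarith) (intervalIntegrable_const (c := q * (a + t / 2) ^ (q - 2) * (t / 2))) hi2
      (fun τ hτ => monotoneOn_shiftedPower_density ha hq (mem_Ici.2 (by positivity))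
        (mem_Ici.2 ((by positivity : (0:ℝ) ≤ t / 2).trans hτ.1)) hτ.1)
    rw [intervalIntegral.integral_const, smul_eq_mul] at h
    have h0 : 0 ≤ shiftedPower a q (t / 2) := shiftedPower_nonneg ha hq (by positivity)
    have hadd := intervalIntegral.integral_add_adjacent_intervals hi1 hi2
    unfold shiftedPower at h0 ⊢
    rw [← hadd]
    linarith
  have h2 : (a + t) ^ (q - 2) ≤ 2 ^ P * (a + t / 2) ^ (q - 2) := by
    rcases le_total 2 q with h | h
    · calc (a + t) ^ (q - 2) ≤ (2 * (a + t / 2)) ^ (q - 2) :=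
            Real.rpow_le_rpow (by positivity) (by linarith) (by linarith)
        _ = 2 ^ (q - 2) * (a + t / 2) ^ (q - 2) :=
            Real.mul_rpow (by norm_num) (by positivity)
        _ ≤ _ := by
            gcongr
            · norm_num
            · linarith
    · calc (a + t) ^ (q - 2) ≤ (a + t / 2) ^ (q - 2) :=
            Real.rpow_le_rpow_of_nonpos (by positivity) (by linarith) (by linarith)
        _ ≤ _ := le_mul_of_one_le_left (by positivity)
            (Real.one_le_rpow (by norm_num) (by linarith))
  have h3 : 0 ≤ (a + t / 2) ^ (q - 2) * t ^ 2 := by positivity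
  calc (a + t) ^ (q - 2) * t ^ 2 ≤ 2 ^ P * (a + t / 2) ^ (q - 2) * t ^ 2 := by gcongr
    _ = 4 * 2 ^ P * (t / 2 * (1 * (a + t / 2) ^ (q - 2) * (t / 2))) := by ring
    _ ≤ 4 * 2 ^ P * (t / 2 * (q * (a + t / 2) ^ (q - 2) * (t / 2))) := by gcongr
    _ ≤ _ := by gcongr

lemma shiftedPower_zero_left {q t : ℝ} (hq : 1 ≤ q) (ht : 0 ≤ t) :
    shiftedPower 0 q t = t ^ q := by
  have h : shiftedPower 0 q t = ∫ τ in (0:ℝ)..t, q * τ ^ (q - 1) := by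
    unfold shiftedPower
    rw [intervalIntegral.integral_of_le ht, intervalIntegral.integral_of_le ht]
    refine setIntegral_congr_fun measurableSet_Ioc fun τ hτ => ?_
    have : τ ^ (q - 1) = τ ^ (q - 2) * τ := by
      rw [show q - 1 = (q - 2) + 1 by ring, Real.rpow_add_one hτ.1.ne']
    simp only [this, zero_add]; ring
  rw [h, intervalIntegral.integral_const_mul, integral_rpow (Or.inl (by linarith)),
    sub_add_cancel, Real.zero_rpow (by linarith), sub_zero]
  field_simp

lemma continuous_shiftedPower {X : Type*} [TopologicalSpace X] {a : ℝ} (ha : 0 ≤ a)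
    {q f : X → ℝ} (hq : Continuous q) (hq1 : ∀ x, 1 ≤ q x)
    (hf : Continuous f) (hf0 : ∀ x, 0 ≤ f x) :
    Continuous fun x => shiftedPower a (q x) (f x) := by
  rcases ha.eq_or_lt with rfl | ha0
  · simp only [fun x => shiftedPower_zero_left (hq1 x) (hf0 x)]
    exact hf.rpow hq fun x => Or.inr (by linarith [hq1 x])
  have h : ∀ x, shiftedPower a (q x) (f x)
      = ∫ τ in (0:ℝ)..f x, q x * (a + |τ|) ^ (q x - 2) * τ := by
    intro x
    refine intervalIntegral.integral_congr fun τ hτ => ?_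
    rw [uIcc_of_le (hf0 x)] at hτ
    simp only [abs_of_nonneg hτ.1]
  simp only [h]
  refine intervalIntegral.continuous_parametric_intervalIntegral_of_continuous ?_ hf
  have hb : Continuous fun z : X × ℝ => (a + |z.2|) ^ (q z.1 - 2) :=
    Continuous.rpow (by fun_prop) (by fun_prop) fun z => Or.inl (by positivity)
  exact ((hq.comp continuous_fst).mul hb).mul continuous_snd

lemma continuousOn_shiftedPower {a q : ℝ} (ha : 0 ≤ a) (hq : 1 ≤ q) :
    ContinuousOn (shiftedPower a q) (Ici 0) := by
  have h : Continuous fun t : ℝ => shiftedPower a q (max t 0) :=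
    continuous_shiftedPower ha continuous_const (fun _ => hq) (by fun_prop)
      fun t => le_max_right _ _
  refine h.continuousOn.congr fun t ht => ?_
  simp only [max_eq_left (mem_Ici.1 ht)]

lemma convexOn_shiftedPower {a q : ℝ} (ha : 0 ≤ a) (hq : 1 ≤ q) :
    ConvexOn ℝ (Ici 0) (shiftedPower a q) := by
  have hd : ∀ t ∈ Ioi (0:ℝ),
      HasDerivAt (shiftedPower a q) (q * (a + t) ^ (q - 2) * t) t := by
    intro t ht
    have ht' : 0 < t := ht
    have hc : ∀ s ∈ Ioi (0:ℝ),
        ContinuousAt (fun τ : ℝ => q * (a + τ) ^ (q - 2) * τ) s := by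
      intro s hs
      have hs' : 0 < s := hs
      have h : ContinuousAt (fun τ : ℝ => (a + τ) ^ (q - 2)) s :=
        ContinuousAt.rpow_const (by fun_prop) (Or.inl (by positivity))
      exact (continuousAt_const.mul h).mul continuousAt_id
    exact intervalIntegral.integral_hasDerivAt_right
      (intervalIntegrable_shiftedPower_density ha hq le_rfl ht'.le)
      (ContinuousAt.stronglyMeasurableAtFilter isOpen_Ioi hc t ht) (hc t ht)
  refine MonotoneOn.convexOn_of_deriv (convex_Ici 0) (continuousOn_shiftedPower ha hq) ?_ ?_
  · rw [interior_Ici]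
    exact fun t ht => (hd t ht).differentiableAt.differentiableWithinAt
  · rw [interior_Ici]
    intro s hs t ht hst
    rw [(hd s hs).deriv, (hd t ht).deriv]
    exact monotoneOn_shiftedPower_density ha hq (Ioi_subset_Ici_self hs)
      (Ioi_subset_Ici_self ht) hst

/-- Raising the exponent costs a bounded factor while `a + t` is not too large. -/
lemma shiftedPower_le_of_add_le {a q p P K t : ℝ} (ha : 0 ≤ a) (hq : 1 ≤ q) (hqp : q ≤ p)
    (hp : p ≤ P) (ht : 0 ≤ t) (hK : (a + t) ^ (p - q) ≤ K) :
    shiftedPower a p t ≤ P * K * (4 * 2 ^ P) * shiftedPower a q t := by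
  rcases ht.eq_or_lt with rfl | ht0
  · simp [shiftedPower]
  have hK0 : 0 ≤ K := le_trans (by positivity) hK
  have hP : 0 ≤ P := by linarith
  calc shiftedPower a p t ≤ p * ((a + t) ^ (p - 2) * t ^ 2) :=
        shiftedPower_le ha (hq.trans hqp) ht
    _ = p * ((a + t) ^ (p - q) * ((a + t) ^ (q - 2) * t ^ 2)) := by
        rw [show p - 2 = (p - q) + (q - 2) by ring, Real.rpow_add (by positivity)]; ring
    _ ≤ P * (K * (4 * 2 ^ P * shiftedPower a q t)) := by
        have := le_shiftedPower ha hq (hqp.trans hp) ht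
        gcongr
    _ = _ := by ring

/-- Lowering the exponent costs a bounded factor while `a + t ≥ ε`, and otherwise the value is
at most of order `ε`. -/
lemma shiftedPower_le_add {a q p P K t ε : ℝ} (ha : 0 ≤ a) (hq : 1 ≤ q) (hqp : q ≤ p)
    (hp : p ≤ P) (ht : 0 ≤ t) (hε : 0 < ε) (hε1 : ε ≤ 1) (hK : ε ^ (q - p) ≤ K) :
    shiftedPower a q t ≤ P * K * (4 * 2 ^ P) * shiftedPower a p t + P * ε := by
  have hK0 : 0 ≤ K := le_trans (by positivity) hK
  have hP : 0 ≤ P := by linarith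
  have hΦ := shiftedPower_nonneg ha (hq.trans hqp) ht
  rcases ht.eq_or_lt with rfl | ht0
  · simp only [shiftedPower, intervalIntegral.integral_same, mul_zero, zero_add]; positivity
  have hle := shiftedPower_le ha hq ht
  rcases le_total ε (a + t) with h | h
  · have h1 : (a + t) ^ (q - p) ≤ K :=
      (Real.rpow_le_rpow_of_nonpos hε h (by linarith)).trans hK
    calc shiftedPower a q t ≤ q * ((a + t) ^ (q - 2) * t ^ 2) := hle
      _ = q * ((a + t) ^ (q - p) * ((a + t) ^ (p - 2) * t ^ 2)) := by
          rw [show q - 2 = (q - p) + (p - 2) by ring, Real.rpow_add (by positivity)]; ring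
      _ ≤ P * (K * (4 * 2 ^ P * shiftedPower a p t)) := by
          have := le_shiftedPower ha (hq.trans hqp) hp ht
          gcongr
          exact hqp.trans hp
      _ = P * K * (4 * 2 ^ P) * shiftedPower a p t := by ring
      _ ≤ _ := le_add_of_nonneg_right (by positivity)
  · calc shiftedPower a q t ≤ q * ((a + t) ^ (q - 2) * t ^ 2) := hle
      _ ≤ q * ((a + t) ^ (q - 2) * (a + t) ^ 2) := by gcongr; linarith
      _ = q * (a + t) ^ q := by
          rw [← Real.rpow_natCast (a + t) 2, ← Real.rpow_add (by positivity)]; norm_num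
      _ ≤ P * ε := by
          gcongr
          · exact hqp.trans hp
          · calc (a + t) ^ q ≤ ε ^ q := Real.rpow_le_rpow (by positivity) h (by linarith)
              _ ≤ ε ^ (1:ℝ) := Real.rpow_le_rpow_of_exponent_ge hε hε1 hq
              _ = ε := Real.rpow_one ε
      _ ≤ _ := le_add_of_nonneg_left (by positivity)

lemma integrable_prod_restrict_of_continuous {X Y : Type*} [TopologicalSpace X]
    [TopologicalSpace Y] [MeasurableSpace X] [MeasurableSpace Y] [OpensMeasurableSpace (X × Y)]
    [T2Space X] [T2Space Y]
    {μ : Measure X} {ν : Measure Y} [SFinite μ] [SFinite ν]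
    [IsFiniteMeasureOnCompacts (μ.prod ν)] {s : Set X} {t : Set Y} (hs : IsCompact s)
    (ht : IsCompact t) {F : X × Y → ℝ} (hF : Continuous F) :
    Integrable F ((μ.restrict s).prod (ν.restrict t)) := by
  rw [Measure.prod_restrict]
  exact hF.continuousOn.integrableOn_compact (hs.prod ht)

section ConvexCombination

variable {E : Type*} [NormedAddCommGroup E] [NormedSpace ℝ E] [FiniteDimensional ℝ E]
  [MeasurableSpace E] [BorelSpace E] {μ : Measure E} [μ.IsAddHaarMeasure] {K : Set E}

lemma setIntegral_comp_convexCombination_le (hK : Convex ℝ K) (hKc : IsCompact K) {g : E → ℝ}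
    (hg : Continuous g) (hg0 : ∀ x, 0 ≤ g x) {x : E} (hx : x ∈ K) {t : ℝ} (ht : 0 < t)
    (ht1 : t ≤ 1) :
    ∫ y in K, g ((1 - t) • x + t • y) ∂μ
      ≤ (t ^ Module.finrank ℝ E)⁻¹ * ∫ y in K, g y ∂μ := by
  have hKm := hKc.measurableSet
  have hi : Integrable (K.indicator g) μ :=
    (integrable_indicator_iff hKm).2 (hg.continuousOn.integrableOn_compact hKc)
  have hi' : Integrable (fun y => K.indicator g ((1 - t) • x + t • y)) μ := by
    have h1 : Integrable (fun y => K.indicator g ((1 - t) • x + y)) μ := hi.comp_add_left _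
    exact h1.comp_smul ht.ne'
  rw [← integral_indicator hKm, ← integral_indicator hKm]
  calc ∫ y, K.indicator (fun y => g ((1 - t) • x + t • y)) y ∂μ
      ≤ ∫ y, K.indicator g ((1 - t) • x + t • y) ∂μ := by
        refine integral_mono ?_ hi' fun y => ?_
        · exact (integrable_indicator_iff hKm).2
            ((by fun_prop : Continuous fun y => g ((1 - t) • x + t • y)).continuousOn
              |>.integrableOn_compact hKc)
        · by_cases hy : y ∈ K
          · have : (1 - t) • x + t • y ∈ K :=
              hK hx hy (by linarith) ht.le (by ring)
            simp [hy, this]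
          · simp only [hy, not_false_eq_true, indicator_of_notMem]
            exact indicator_nonneg (fun z _ => hg0 z) _
    _ = _ := by
        rw [Measure.integral_comp_smul_of_nonneg μ
          (fun y => K.indicator g ((1 - t) • x + y)) t (hR := ht.le),
          integral_add_left_eq_self (fun y => K.indicator g y), smul_eq_mul]

lemma integral_integral_integral_convexCombination_le (hK : Convex ℝ K) (hKc : IsCompact K)
    {g : E → ℝ} (hg : Continuous g) (hg0 : ∀ x, 0 ≤ g x) :
    ∫ x in K, ∫ t in Icc (0:ℝ) 1, ∫ y in K, g ((1 - t) • x + t • y) ∂μ ∂volume ∂μ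
      ≤ 2 ^ Module.finrank ℝ E * μ.real K * ∫ y in K, g y ∂μ := by
  set N := Module.finrank ℝ E
  set I := ∫ y in K, g y ∂μ with hI
  have hI0 : 0 ≤ I := integral_nonneg hg0
  have hKfin : μ K ≠ ⊤ := hKc.measure_ne_top
  have hcont : Continuous fun z : E × ℝ => ∫ y in K, g ((1 - z.2) • z.1 + z.2 • y) ∂μ :=
    continuous_parametric_integral_of_continuous
      (f := fun (z : E × ℝ) y => g ((1 - z.2) • z.1 + z.2 • y)) (by fun_prop) hKc
  have hpow : ∀ s : ℝ, 1 / 2 ≤ s → (s ^ N)⁻¹ ≤ 2 ^ N := by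
    intro s hs
    rw [← inv_pow]
    have h2 : s⁻¹ ≤ 2 := by
      rw [inv_le_comm₀ (by linarith) (by norm_num)]; linarith
    exact pow_le_pow_left₀ (by positivity) h2 _
  have hbound : ∀ s : ℝ, 1 / 2 ≤ s → s ≤ 1 →
      ∫ x in K, ∫ y in K, g ((1 - s) • x + s • y) ∂μ ∂μ ≤ 2 ^ N * μ.real K * I := by
    intro s hs hs1
    have hc : Continuous fun x => ∫ y in K, g ((1 - s) • x + s • y) ∂μ :=
      hcont.comp (by fun_prop : Continuous fun x : E => (x, s))
    calc ∫ x in K, ∫ y in K, g ((1 - s) • x + s • y) ∂μ ∂μ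
        ≤ ∫ x in K, 2 ^ N * I ∂μ := by
          refine setIntegral_mono_on (hc.continuousOn.integrableOn_compact hKc)
            (integrableOn_const hKfin) hKc.measurableSet fun x hx => ?_
          refine (setIntegral_comp_convexCombination_le hK hKc hg hg0 hx (by linarith) hs1).trans
            ?_
          gcongr
          exact hpow s hs
      _ = 2 ^ N * μ.real K * I := by
          rw [setIntegral_const, smul_eq_mul]; ring
  rw [integral_integral_swap (integrable_prod_restrict_of_continuous hKc isCompact_Icc hcont)]
  have hc2 : Continuous fun t : ℝ => ∫ x in K, ∫ y in K, g ((1 - t) • x + t • y) ∂μ ∂μ :=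
    continuous_parametric_integral_of_continuous
      (f := fun (t : ℝ) (x : E) => ∫ y in K, g ((1 - t) • x + t • y) ∂μ)
      (hcont.comp continuous_swap) hKc
  calc ∫ t in Icc (0:ℝ) 1, ∫ x in K, ∫ y in K, g ((1 - t) • x + t • y) ∂μ ∂μ
      ≤ ∫ t in Icc (0:ℝ) 1, 2 ^ N * μ.real K * I := by
        refine setIntegral_mono_on (hc2.continuousOn.integrableOn_compact isCompact_Icc)
          (integrableOn_const (by simp)) measurableSet_Icc fun t ht => ?_
        rcases le_total (1 / 2) t with h | h
        · exact hbound t h ht.2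
        · rw [integral_integral_swap (integrable_prod_restrict_of_continuous hKc hKc
            (F := Function.uncurry fun x y => g ((1 - t) • x + t • y)) (by fun_prop))]
          refine le_trans (le_of_eq ?_) (hbound (1 - t) (by linarith) (by linarith [ht.1]))
          simp only [sub_sub_cancel, add_comm]
    _ = _ := by simp

lemma abs_sub_setAverage_le (hKc : IsCompact K) (hK0 : μ K ≠ 0) {u : E → ℝ}
    (hu : ContDiff ℝ 1 u) {d : ℝ} (hd : ∀ x ∈ K, ∀ y ∈ K, ‖y - x‖ ≤ d) {x : E} (hx : x ∈ K) :
    |u x - ⨍ y in K, u y ∂μ|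
      ≤ d * ∫ t in Icc (0:ℝ) 1, ⨍ y in K, ‖fderiv ℝ u ((1 - t) • x + t • y)‖ ∂μ := by
  have hKfin : μ K ≠ ⊤ := hKc.measure_ne_top
  have hfd : Continuous (fderiv ℝ u) := hu.continuous_fderiv one_ne_zero
  have hV : 0 < μ.real K := ENNReal.toReal_pos hK0 hKfin
  have hF : Continuous fun z : E × ℝ => ‖fderiv ℝ u ((1 - z.2) • x + z.2 • z.1)‖ := by fun_prop
  have hline : ∀ y ∈ K,
      |u x - u y| ≤ d * ∫ t in Icc (0:ℝ) 1, ‖fderiv ℝ u ((1 - t) • x + t • y)‖ := by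
    intro y hy
    have hderiv : ∀ t : ℝ, HasDerivAt (fun t : ℝ => u ((1 - t) • x + t • y))
        (fderiv ℝ u ((1 - t) • x + t • y) (y - x)) t := by
      intro t
      have h1 : HasDerivAt (fun t : ℝ => (1 - t) • x + t • y) (y - x) t := by
        have h := (((hasDerivAt_id t).const_sub 1).smul_const x).add
          ((hasDerivAt_id t).smul_const y)
        rwa [neg_one_smul, one_smul, neg_add_eq_sub] at h
      exact ((hu.differentiable one_ne_zero) _).hasFDerivAt.comp_hasDerivAt t h1
    have hcd : Continuous fun t : ℝ => fderiv ℝ u ((1 - t) • x + t • y) (y - x) := by fun_prop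
    have hftc := intervalIntegral.integral_eq_sub_of_hasDerivAt (a := 0) (b := 1)
      (fun t _ => hderiv t) (hcd.intervalIntegrable _ _)
    simp only [sub_self, zero_smul, one_smul, zero_add, sub_zero, add_zero] at hftc
    rw [abs_sub_comm, ← hftc, integral_Icc_eq_integral_Ioc,
      ← intervalIntegral.integral_of_le zero_le_one, ← intervalIntegral.integral_const_mul,
      ← Real.norm_eq_abs]
    refine intervalIntegral.norm_integral_le_of_norm_le zero_le_one ?_
      ((by fun_prop : Continuous fun t : ℝ =>
        d * ‖fderiv ℝ u ((1 - t) • x + t • y)‖).intervalIntegrable _ _)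
    refine .of_forall fun t _ => ?_
    calc ‖fderiv ℝ u ((1 - t) • x + t • y) (y - x)‖
        ≤ ‖fderiv ℝ u ((1 - t) • x + t • y)‖ * ‖y - x‖ := ContinuousLinearMap.le_opNorm _ _
      _ ≤ ‖fderiv ℝ u ((1 - t) • x + t • y)‖ * d := by gcongr; exact hd x hx y hy
      _ = _ := mul_comm _ _
  have hui : IntegrableOn u K μ := hu.continuous.continuousOn.integrableOn_compact hKc
  have havg : u x - ⨍ y in K, u y ∂μ = (μ.real K)⁻¹ * ∫ y in K, (u x - u y) ∂μ := by
    rw [integral_sub (integrableOn_const (C := u x) hKfin).integrable hui, setIntegral_const,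
      setAverage_eq,
      smul_eq_mul, smul_eq_mul]
    field_simp
  have hcI : Continuous fun y => ∫ t in Icc (0:ℝ) 1, ‖fderiv ℝ u ((1 - t) • x + t • y)‖ :=
    continuous_parametric_integral_of_continuous
      (f := fun y (t : ℝ) => ‖fderiv ℝ u ((1 - t) • x + t • y)‖) hF isCompact_Icc
  have hswap : ∫ t in Icc (0:ℝ) 1, ⨍ y in K, ‖fderiv ℝ u ((1 - t) • x + t • y)‖ ∂μ
      = (μ.real K)⁻¹ *
        ∫ y in K, ∫ t in Icc (0:ℝ) 1, ‖fderiv ℝ u ((1 - t) • x + t • y)‖ ∂volume ∂μ := by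
    simp only [setAverage_eq, smul_eq_mul]
    rw [integral_const_mul, integral_integral_swap
      (integrable_prod_restrict_of_continuous hKc isCompact_Icc hF)]
  rw [hswap, havg, abs_mul, abs_of_pos (inv_pos.2 hV), mul_left_comm, ← integral_const_mul]
  gcongr
  refine (abs_integral_le_integral_abs).trans ?_
  exact setIntegral_mono_on
    ((by fun_prop : Continuous fun y => |u x - u y|).continuousOn.integrableOn_compact hKc)
    ((hcI.const_mul d).continuousOn.integrableOn_compact hKc) hKc.measurableSet hline

end ConvexCombination

lemma LogHolder.abs_sub_le {n : ℕ} {C : ℝ} {p : (Fin n → ℝ) → ℝ} (hp : LogHolder n C p)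
    {r : ℝ} (hr : 0 < r) {x y : Fin n → ℝ} (hxy : ‖x - y‖ ≤ r) :
    |p x - p y| ≤ |C| / Real.log (Real.exp 1 + 1 / r) := by
  have hL : 1 ≤ Real.log (Real.exp 1 + 1 / r) := by
    rw [Real.le_log_iff_exp_le (by positivity)]
    exact le_add_of_nonneg_right (by positivity)
  rcases eq_or_ne x y with rfl | hne
  · simp only [sub_self, abs_zero]; positivity
  · have h0 : 0 < ‖x - y‖ := norm_pos_iff.2 (sub_ne_zero.2 hne)
    refine (hp x y hne).trans (div_le_div₀ (abs_nonneg C) (le_abs_self C) (by linarith) ?_)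
    exact Real.log_le_log (by positivity) (by gcongr)

lemma LogHolder.continuous {n : ℕ} {C : ℝ} {p : (Fin n → ℝ) → ℝ} (hp : LogHolder n C p) :
    Continuous p := by
  refine Metric.continuous_iff.2 fun x ε hε => ?_
  set N := |C| / ε + 1 with hN
  have hN0 : 0 < N := by positivity
  refine ⟨Real.exp (-N), Real.exp_pos _, fun y hy => ?_⟩
  rw [dist_eq_norm] at hy
  rw [Real.dist_eq]
  have hlog : N ≤ Real.log (Real.exp 1 + 1 / Real.exp (-N)) := by
    rw [Real.le_log_iff_exp_le (by positivity), one_div, ← Real.exp_neg, neg_neg]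
    exact le_add_of_nonneg_left (by positivity)
  calc |p y - p x| ≤ |C| / Real.log (Real.exp 1 + 1 / Real.exp (-N)) :=
        hp.abs_sub_le (Real.exp_pos _) hy.le
    _ ≤ |C| / N := by gcongr
    _ < ε := by
        rw [div_lt_iff₀ hN0, hN, mul_add, mul_div_cancel₀ _ hε.ne']
        linarith

lemma LogHolder.rpow_le {n : ℕ} {C : ℝ} {p : (Fin n → ℝ) → ℝ} (hp : LogHolder n C p)
    {M r : ℝ} (hM : 0 ≤ M) (hr : 0 < r) {x y : Fin n → ℝ} (hxy : ‖x - y‖ ≤ r) :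
    (r ^ (-M)) ^ |p x - p y| ≤ Real.exp (M * |C|) := by
  set L := Real.log (Real.exp 1 + 1 / r) with hLdef
  have hL : 1 ≤ L := by
    rw [hLdef, Real.le_log_iff_exp_le (by positivity)]
    exact le_add_of_nonneg_right (by positivity)
  have hlog : -Real.log r ≤ L := by
    rw [← Real.log_inv, inv_eq_one_div]
    exact Real.log_le_log (by positivity) (le_add_of_nonneg_left (by positivity))
  rw [← Real.rpow_mul hr.le, Real.rpow_def_of_pos hr, Real.exp_le_exp]
  calc Real.log r * (-M * |p x - p y|) = M * (-Real.log r * |p x - p y|) := by ring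
    _ ≤ M * (L * (|C| / L)) := by
        gcongr
        exact hp.abs_sub_le hr hxy
    _ = M * |C| := by field_simp

/-- Jensen's inequality for the shifted powers with variable exponent, up to a constant and a
small additive error. -/
lemma shiftedPower_setAverage_le {n : ℕ} {C P M : ℝ} {p : (Fin n → ℝ) → ℝ}
    (hp1 : ∀ x, 1 ≤ p x) (hpP : ∀ x, p x ≤ P) (hp : LogHolder n C p) (hM : 0 ≤ M)
    {K : Set (Fin n → ℝ)} (hKc : IsCompact K) (hK0 : volume K ≠ 0)
    {w : (Fin n → ℝ) → (Fin n → ℝ)} (hw : Continuous w) {r : ℝ} (hr : 0 < r) (hr1 : r ≤ 1)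
    (hwr : ∀ x ∈ K, ∀ y ∈ K, ‖w x - w y‖ ≤ r) {a : ℝ} (ha : 0 ≤ a)
    {f : (Fin n → ℝ) → ℝ} (hf : Continuous f) (hf0 : ∀ x, 0 ≤ f x)
    (hT : a + ⨍ y in K, f (w y) ≤ r ^ (-M)) {x : Fin n → ℝ} (hx : x ∈ K) :
    shiftedPower a (p (w x)) (⨍ y in K, f (w y))
      ≤ (P * Real.exp (M * |C|) * (4 * 2 ^ P)) *
        ((P * Real.exp (M * |C|) * (4 * 2 ^ P)) *
          (⨍ y in K, shiftedPower a (p (w y)) (f (w y))) + P * r ^ M) := by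
  have hpc := hp.continuous
  obtain ⟨y₀, hy₀, hmin⟩ := hKc.exists_isMinOn ⟨x, hx⟩ (hpc.comp hw).continuousOn
  have hmin' : ∀ y ∈ K, p (w y₀) ≤ p (w y) := fun y hy => hmin hy
  set q := p (w y₀) with hq
  set A := P * Real.exp (M * |C|) * (4 * 2 ^ P) with hA
  have hP : 0 ≤ P := by linarith [hp1 x, hpP x]
  have hA0 : 0 ≤ A := by positivity
  have hKfin : volume K ≠ ⊤ := hKc.measure_ne_top
  have hq1 : 1 ≤ q := hp1 _
  have hosc : ∀ y ∈ K, (r ^ (-M)) ^ (p (w y) - q) ≤ Real.exp (M * |C|) := by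
    intro y hy
    have := hp.rpow_le hM hr (hwr y hy y₀ hy₀)
    rwa [← hq, abs_of_nonneg (by linarith [hmin' y hy])] at this
  have hT0 : 0 ≤ ⨍ y in K, f (w y) := by
    rw [setAverage_eq]
    exact smul_nonneg (by positivity) (integral_nonneg fun y => hf0 _)
  have hstep1 : shiftedPower a (p (w x)) (⨍ y in K, f (w y))
      ≤ A * shiftedPower a q (⨍ y in K, f (w y)) := by
    refine shiftedPower_le_of_add_le ha hq1 (hmin' x hx) (hpP _) hT0 ?_
    exact (Real.rpow_le_rpow (by positivity) hT (by linarith [hmin' x hx])).trans (hosc x hx)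
  have hcq : Continuous fun y => shiftedPower a q (f (w y)) :=
    continuous_shiftedPower ha continuous_const (fun _ => hq1) (hf.comp hw) fun _ => hf0 _
  have hcp : Continuous fun y => shiftedPower a (p (w y)) (f (w y)) :=
    continuous_shiftedPower ha (hpc.comp hw) (fun _ => hp1 _) (hf.comp hw) fun _ => hf0 _
  have hiq : IntegrableOn (fun y => shiftedPower a q (f (w y))) K :=
    hcq.continuousOn.integrableOn_compact hKc
  have hip : IntegrableOn (fun y => shiftedPower a (p (w y)) (f (w y))) K :=
    hcp.continuousOn.integrableOn_compact hKc
  have hjensen : shiftedPower a q (⨍ y in K, f (w y))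
      ≤ ⨍ y in K, shiftedPower a q (f (w y)) :=
    (convexOn_shiftedPower ha hq1).map_set_average_le (continuousOn_shiftedPower ha hq1)
      isClosed_Ici hK0 hKfin (.of_forall fun y => hf0 _)
      ((hf.comp hw).continuousOn.integrableOn_compact hKc) hiq
  have hV : 0 < volume.real K := ENNReal.toReal_pos hK0 hKfin
  have hstep2 : ⨍ y in K, shiftedPower a q (f (w y))
      ≤ A * (⨍ y in K, shiftedPower a (p (w y)) (f (w y))) + P * r ^ M := by
    have hle : ∫ y in K, shiftedPower a q (f (w y))
        ≤ ∫ y in K, (A * shiftedPower a (p (w y)) (f (w y)) + P * r ^ M) := by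
      refine setIntegral_mono_on hiq ((hip.const_mul A).add (integrableOn_const hKfin))
        hKc.measurableSet fun y hy => ?_
      refine shiftedPower_le_add ha hq1 (hmin' y hy) (hpP _) (hf0 _) (by positivity)
        (Real.rpow_le_one hr.le hr1 hM) ?_
      refine le_trans (le_of_eq ?_) (hosc y hy)
      rw [← Real.rpow_mul hr.le, ← Real.rpow_mul hr.le]
      congr 1; ring
    rw [integral_add (hip.const_mul A) (integrableOn_const hKfin), integral_const_mul,
      setIntegral_const, smul_eq_mul] at hle
    simp only [setAverage_eq, smul_eq_mul]
    calc (volume.real K)⁻¹ * ∫ y in K, shiftedPower a q (f (w y))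
        ≤ (volume.real K)⁻¹ * (A * (∫ y in K, shiftedPower a (p (w y)) (f (w y)))
          + volume.real K * (P * r ^ M)) := by gcongr
      _ = _ := by field_simp
  calc _ ≤ A * shiftedPower a q (⨍ y in K, f (w y)) := hstep1
    _ ≤ _ := by
        gcongr
        exact hjensen.trans hstep2

lemma volume_real_cube (n : ℕ) (z : Fin n → ℝ) {ℓ : ℝ} (hℓ : 0 ≤ ℓ) :
    volume.real (cube n z ℓ) = ℓ ^ n := by
  have h : z ≤ fun i => z i + ℓ := fun i => le_add_of_nonneg_right hℓ
  simp [cube, Measure.real, Real.volume_Icc_pi_toReal h]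

lemma norm_sub_le_of_mem_cube {n : ℕ} {z : Fin n → ℝ} {ℓ : ℝ} (hℓ : 0 ≤ ℓ) {x y : Fin n → ℝ}
    (hx : x ∈ cube n z ℓ) (hy : y ∈ cube n z ℓ) : ‖x - y‖ ≤ ℓ := by
  refine (pi_norm_le_iff_of_nonneg hℓ).2 fun i => ?_
  have h1 := hx.1 i
  have h2 := hx.2 i
  have h3 := hy.1 i
  have h4 := hy.2 i
  simp only [Pi.sub_apply, Real.norm_eq_abs, abs_le]
  constructor <;> linarith

/-- Poincaré type estimate for shifted variable-exponent functions: if `p : ℝⁿ → [1,∞)` is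
locally log-Hölder continuous with constant `C` and `p⁺ < ∞`, then for every `m > 0` there
is `c = c(m, C, p⁺) > 0` such that for every cube `Q` with `ℓ(Q) ≤ 1`, every `a ≥ 0` and
every `u ∈ C¹` with `a + ⨍_Q |∇u| ≤ max {1, |Q|^{-m}}` one has
`∫_Q φ_a(x, |u(x) - ⟨u⟩_Q| / ℓ(Q)) dx ≤ c ∫_Q φ_a(x, |∇u(x)|) dx + c |Q|^m`. -/
theorem poincare_shifted (n : ℕ) (C pplus m : ℝ) (hm : 0 < m) :
    ∃ c : ℝ, 0 < c ∧
      ∀ p : (Fin n → ℝ) → ℝ, Measurable p →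
        (∀ x, 1 ≤ p x) → (∀ x, p x ≤ pplus) → LogHolder n C p →
        ∀ (z : Fin n → ℝ) (ℓ : ℝ), 0 < ℓ → ℓ ≤ 1 →
          ∀ a : ℝ, 0 ≤ a →
          ∀ u : (Fin n → ℝ) → ℝ, ContDiff ℝ 1 u →
            a + (⨍ y in cube n z ℓ, ‖fderiv ℝ u y‖) ≤
              max 1 ((volume (cube n z ℓ)).toReal ^ (-m)) →
            (∫ x in cube n z ℓ,
                phiShift n p a x (|u x - ⨍ y in cube n z ℓ, u y| / ℓ)) ≤
              c * (∫ x in cube n z ℓ, phiShift n p a x ‖fderiv ℝ u x‖) +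
                c * (volume (cube n z ℓ)).toReal ^ m := by
  obtain ⟨P, hPdef⟩ : ∃ P, P = max pplus 1 := ⟨_, rfl⟩
  obtain ⟨M, hMdef⟩ : ∃ M : ℝ, M = n * (m + 1) := ⟨_, rfl⟩
  obtain ⟨A, hAdef⟩ : ∃ A, A = P * Real.exp (M * |C|) * (4 * 2 ^ P) := ⟨_, rfl⟩
  have hP1 : 1 ≤ P := hPdef ▸ le_max_right _ _
  have hM0 : 0 ≤ M := by rw [hMdef]; positivity
  have hA0 : 0 < A := by rw [hAdef]; positivity
  refine ⟨A * A * 2 ^ n + A * P, by positivity, ?_⟩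
  intro p _ hp1 hpp hp z ℓ hℓ hℓ1 a ha u hu hsmall
  have hpP : ∀ x, p x ≤ P := fun x => (hpp x).trans (hPdef ▸ le_max_left _ _)
  have hpc := hp.continuous
  set K := cube n z ℓ with hKdef
  have hKc : IsCompact K := isCompact_Icc
  have hK : Convex ℝ K := convex_Icc _ _
  have hVeq : volume.real K = ℓ ^ n := volume_real_cube n z hℓ.le
  rw [← measureReal_def] at hsmall ⊢
  set V := volume.real K with hVdef
  have hV : 0 < V := by rw [hVeq]; positivity
  have hV1 : V ≤ 1 := by rw [hVeq]; exact pow_le_one₀ hℓ.le hℓ1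
  have hK0 : volume K ≠ 0 := fun h => hV.ne' (by rw [hVdef, measureReal_def, h]; rfl)
  have hKfin : volume K ≠ ⊤ := hKc.measure_ne_top
  have hfd : Continuous (fderiv ℝ u) := hu.continuous_fderiv one_ne_zero
  obtain ⟨f, hfdef⟩ : ∃ f : (Fin n → ℝ) → ℝ, f = fun x => ‖fderiv ℝ u x‖ := ⟨_, rfl⟩
  have hf : Continuous f := by rw [hfdef]; fun_prop
  have hf0 : ∀ x, 0 ≤ f x := fun x => by rw [hfdef]; exact norm_nonneg _
  have hsmall' : a + ⨍ y in K, f y ≤ V ^ (-m) := by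
    rw [max_eq_right (Real.one_le_rpow_of_pos_of_le_one_of_nonpos hV hV1 (by linarith))] at hsmall
    rwa [hfdef]
  obtain ⟨G, hGdef⟩ : ∃ G : (Fin n → ℝ) → ℝ, G = fun x => shiftedPower a (p x) (f x) :=
    ⟨_, rfl⟩
  have hG : Continuous G := by
    rw [hGdef]; exact continuous_shiftedPower ha hpc hp1 hf hf0
  have hG0 : ∀ x, 0 ≤ G x := fun x => by
    rw [hGdef]; exact shiftedPower_nonneg ha (hp1 x) (hf0 x)
  have hcG : Continuous fun v : (Fin n → ℝ) × ℝ => ∫ y in K, G ((1 - v.2) • v.1 + v.2 • y) :=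
    continuous_parametric_integral_of_continuous
      (f := fun (v : (Fin n → ℝ) × ℝ) y => G ((1 - v.2) • v.1 + v.2 • y)) (by fun_prop) hKc
  have hcH : Continuous fun x =>
      ∫ t in Icc (0:ℝ) 1, ∫ y in K, G ((1 - t) • x + t • y) :=
    continuous_parametric_integral_of_continuous
      (f := fun x (t : ℝ) => ∫ y in K, G ((1 - t) • x + t • y)) hcG isCompact_Icc
  have hpoint : ∀ x ∈ K, shiftedPower a (p x) (|u x - ⨍ y in K, u y| / ℓ)
      ≤ A * A * V⁻¹ * (∫ t in Icc (0:ℝ) 1, ∫ y in K, G ((1 - t) • x + t • y))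
        + A * P * V ^ m := by
    intro x hx
    obtain ⟨T, hTdef⟩ : ∃ T : ℝ → ℝ, T = fun t => ⨍ y in K, f ((1 - t) • x + t • y) :=
      ⟨_, rfl⟩
    have hTc : Continuous T := by
      rw [hTdef]
      have hc : Continuous fun t : ℝ => ∫ y in K, f ((1 - t) • x + t • y) :=
        continuous_parametric_integral_of_continuous
          (f := fun (t : ℝ) y => f ((1 - t) • x + t • y)) (by fun_prop) hKc
      simp only [setAverage_eq, smul_eq_mul]
      exact hc.const_mul _
    have hT0 : ∀ t, 0 ≤ T t := fun t => by
      rw [hTdef]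
      simp only [setAverage_eq]
      exact smul_nonneg (by positivity) (integral_nonneg fun y => hf0 _)
    have hpoinc : |u x - ⨍ y in K, u y| / ℓ ≤ ∫ t in Icc (0:ℝ) 1, T t := by
      rw [div_le_iff₀' hℓ, hTdef, hfdef]
      exact abs_sub_setAverage_le hKc hK0 hu
        (fun x hx y hy => norm_sub_le_of_mem_cube hℓ.le hy hx) hx
    have hcΦ : Continuous fun t => shiftedPower a (p x) (T t) :=
      continuous_shiftedPower ha continuous_const (fun _ => hp1 x) hTc hT0
    have hprob : IsProbabilityMeasure (volume.restrict (Icc (0:ℝ) 1)) := ⟨by simp⟩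
    have hiΦ : IntegrableOn (fun t => shiftedPower a (p x) (T t)) (Icc 0 1) :=
      hcΦ.continuousOn.integrableOn_compact isCompact_Icc
    have hjensen : shiftedPower a (p x) (∫ t in Icc (0:ℝ) 1, T t)
        ≤ ∫ t in Icc (0:ℝ) 1, shiftedPower a (p x) (T t) :=
      (convexOn_shiftedPower ha (hp1 x)).map_integral_le (continuousOn_shiftedPower ha (hp1 x))
        isClosed_Ici (.of_forall hT0) (hTc.continuousOn.integrableOn_compact isCompact_Icc) hiΦ
    have hcIt : Continuous fun t : ℝ => ∫ y in K, G ((1 - t) • x + t • y) :=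
      hcG.comp (by fun_prop : Continuous fun t : ℝ => (x, t))
    have hscale : ∀ t ∈ Ioc (0:ℝ) 1, shiftedPower a (p x) (T t)
        ≤ A * A * V⁻¹ * (∫ y in K, G ((1 - t) • x + t • y)) + A * P * V ^ m := by
      intro t ht
      have ht0 : 0 < t := ht.1
      have hTle : T t ≤ (t ^ n)⁻¹ * ⨍ y in K, f y := by
        have h := setIntegral_comp_convexCombination_le (μ := volume) hK hKc hf hf0 hx ht0 ht.2
        rw [Module.finrank_fin_fun] at h
        rw [hTdef]
        simp only [setAverage_eq, smul_eq_mul]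
        rw [mul_left_comm]
        gcongr
      have htn : 1 ≤ (t ^ n)⁻¹ := (one_le_inv₀ (by positivity)).2 (pow_le_one₀ ht0.le ht.2)
      have hVpow : ∀ s : ℝ, V ^ s = ℓ ^ (n * s) := fun s => by
        rw [hVeq, ← Real.rpow_natCast, ← Real.rpow_mul hℓ.le]
      have hbound : a + T t ≤ (t * ℓ) ^ (-M) := by
        calc a + T t ≤ (t ^ n)⁻¹ * a + (t ^ n)⁻¹ * ⨍ y in K, f y :=
              add_le_add (le_mul_of_one_le_left ha htn) hTle
          _ = (t ^ n)⁻¹ * (a + ⨍ y in K, f y) := by ring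
          _ ≤ (t ^ n)⁻¹ * V ^ (-m) := by gcongr
          _ = t ^ (-(n:ℝ)) * ℓ ^ (n * -m) := by
              rw [hVpow, Real.rpow_neg ht0.le, Real.rpow_natCast]
          _ ≤ t ^ (-M) * ℓ ^ (-M) := by
              have hn : (0:ℝ) ≤ n := n.cast_nonneg
              have h1 : t ^ (-(n:ℝ)) ≤ t ^ (-M) :=
                Real.rpow_le_rpow_of_exponent_ge ht0 ht.2 (by rw [hMdef]; nlinarith)
              have h2 : ℓ ^ (n * -m) ≤ ℓ ^ (-M) :=
                Real.rpow_le_rpow_of_exponent_ge hℓ hℓ1 (by rw [hMdef]; nlinarith)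
              gcongr
          _ = _ := (Real.mul_rpow ht0.le hℓ.le).symm
      have herr : (t * ℓ) ^ M ≤ V ^ m := by
        have hn : (0:ℝ) ≤ n := n.cast_nonneg
        calc (t * ℓ) ^ M ≤ ℓ ^ M :=
              Real.rpow_le_rpow (by positivity) (mul_le_of_le_one_left hℓ.le ht.2) hM0
          _ ≤ ℓ ^ (n * m) :=
              Real.rpow_le_rpow_of_exponent_ge hℓ hℓ1 (by rw [hMdef]; nlinarith)
          _ = V ^ m := (hVpow m).symm
      have hkey := shiftedPower_setAverage_le hp1 hpP hp hM0 hKc hK0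
        (w := fun y => (1 - t) • x + t • y) (by fun_prop) (r := t * ℓ) (by positivity)
        (mul_le_one₀ ht.2 hℓ.le hℓ1)
        (fun y hy y' hy' => by
          rw [add_sub_add_left_eq_sub, ← smul_sub, norm_smul, Real.norm_of_nonneg ht0.le]
          exact mul_le_mul_of_nonneg_left (norm_sub_le_of_mem_cube hℓ.le hy hy') ht0.le)
        ha hf hf0 (by rw [hTdef] at hbound; exact hbound) hx
      have hwx : (1 - t) • x + t • x = x := by rw [← add_smul, sub_add_cancel, one_smul]
      simp only [hwx, ← hAdef] at hkey
      rw [hTdef]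
      refine hkey.trans ?_
      have havg : ⨍ y in K, shiftedPower a (p ((1 - t) • x + t • y)) (f ((1 - t) • x + t • y))
          = V⁻¹ * ∫ y in K, G ((1 - t) • x + t • y) := by
        rw [setAverage_eq, hGdef, smul_eq_mul]
      rw [havg]
      calc A * (A * (V⁻¹ * ∫ y in K, G ((1 - t) • x + t • y)) + P * (t * ℓ) ^ M)
          ≤ A * (A * (V⁻¹ * ∫ y in K, G ((1 - t) • x + t • y)) + P * V ^ m) := by gcongr
        _ = _ := by ring
    have hiIt : IntegrableOn
        (fun t : ℝ => A * A * V⁻¹ * ∫ y in K, G ((1 - t) • x + t • y)) (Icc 0 1) :=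
      (hcIt.const_mul _).continuousOn.integrableOn_compact isCompact_Icc
    have hiC : IntegrableOn (fun _ : ℝ => A * P * V ^ m) (Icc 0 1) :=
      integrableOn_const (by simp)
    calc shiftedPower a (p x) (|u x - ⨍ y in K, u y| / ℓ)
        ≤ shiftedPower a (p x) (∫ t in Icc (0:ℝ) 1, T t) :=
          shiftedPower_mono ha (hp1 x) (mem_Ici.2 (by positivity))
            (mem_Ici.2 (integral_nonneg hT0)) hpoinc
      _ ≤ ∫ t in Icc (0:ℝ) 1, shiftedPower a (p x) (T t) := hjensen
      _ ≤ ∫ t in Icc (0:ℝ) 1,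
            (A * A * V⁻¹ * (∫ y in K, G ((1 - t) • x + t • y)) + A * P * V ^ m) := by
          rw [integral_Icc_eq_integral_Ioc, integral_Icc_eq_integral_Ioc]
          exact setIntegral_mono_on (hiΦ.mono_set Ioc_subset_Icc_self)
            ((hiIt.add hiC).mono_set Ioc_subset_Icc_self) measurableSet_Ioc hscale
      _ = _ := by
          rw [integral_add hiIt hiC, integral_const_mul]
          simp
  have hcL : Continuous fun x => shiftedPower a (p x) (|u x - ⨍ y in K, u y| / ℓ) :=
    continuous_shiftedPower ha hpc hp1 (by have := hu.continuous; fun_prop)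
      fun x => by positivity
  have hiH : IntegrableOn (fun x => A * A * V⁻¹ *
      ∫ t in Icc (0:ℝ) 1, ∫ y in K, G ((1 - t) • x + t • y)) K :=
    (hcH.const_mul _).continuousOn.integrableOn_compact hKc
  have hiC : IntegrableOn (fun _ : Fin n → ℝ => A * P * V ^ m) K := integrableOn_const hKfin
  have hI0 : 0 ≤ ∫ y in K, G y := integral_nonneg hG0
  have hdouble := integral_integral_integral_convexCombination_le (μ := volume) hK hKc hG hG0
  rw [Module.finrank_fin_fun, ← hVdef] at hdouble
  have hRHS : ∫ x in K, phiShift n p a x ‖fderiv ℝ u x‖ = ∫ x in K, G x := by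
    rw [hGdef, hfdef]; rfl
  rw [hRHS]
  calc ∫ x in K, shiftedPower a (p x) (|u x - ⨍ y in K, u y| / ℓ)
      ≤ ∫ x in K, (A * A * V⁻¹ *
          (∫ t in Icc (0:ℝ) 1, ∫ y in K, G ((1 - t) • x + t • y)) + A * P * V ^ m) :=
        setIntegral_mono_on (hcL.continuousOn.integrableOn_compact hKc) (hiH.add hiC)
          hKc.measurableSet hpoint
    _ = A * A * V⁻¹ * (∫ x in K, ∫ t in Icc (0:ℝ) 1, ∫ y in K, G ((1 - t) • x + t • y))
          + V * (A * P * V ^ m) := by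
        rw [integral_add hiH hiC, integral_const_mul, setIntegral_const, smul_eq_mul]
    _ ≤ A * A * V⁻¹ * (2 ^ n * V * ∫ y in K, G y) + 1 * (A * P * V ^ m) := by gcongr
    _ = A * A * 2 ^ n * (∫ y in K, G y) + A * P * V ^ m := by field_simp
    _ ≤ (A * A * 2 ^ n + A * P) * (∫ y in K, G y) + (A * A * 2 ^ n + A * P) * V ^ m := by
        have h1 : A * A * 2 ^ n ≤ A * A * 2 ^ n + A * P :=
          le_add_of_nonneg_right (by positivity)
        have h2 : A * P ≤ A * A * 2 ^ n + A * P := le_add_of_nonneg_left (by positivity)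
        gcongr
end
end

section
/- Let 1 < p⁻ ≤ p⁺ < ∞ and let p : Ω → [p⁻, p⁺] be any exponent. Then there exists c ≥ 1, depending only on p⁻ and p⁺, such that for every κ ∈ [0,1], every x ∈ Ω, and all P, Q ∈ ℝ^{N×n}, the three quantities (A(x,P) − A(x,Q)) : (P − Q), |F(x,P) − F(x,Q)|², and φ_{|P|}(x, |P − Q|) are pairwise comparable with constant c (each is at most c times each other), where φ(x,t) := ∫₀ᵗ (κ+s)^{p(x)−2} s ds and φ_a(x,t) := ∫₀ᵗ (φ'(x, a+τ)/(a+τ)) τ dτ. -/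
open Set
open scoped RealInnerProductSpace

noncomputable section

/-- `A(x,ξ) = (κ + |ξ|)^(pₓ - 2) ξ` on `N × n` matrices (Frobenius norm, realized as the
Euclidean norm on `ℝ^{N×n}`), for the exponent value `pₓ`. -/
def Amap (N n : ℕ) (px κ : ℝ) (ξ : EuclideanSpace ℝ (Fin N × Fin n)) :
    EuclideanSpace ℝ (Fin N × Fin n) :=
  ((κ + ‖ξ‖) ^ (px - 2)) • ξ

/-- `F(x,ξ) = (κ + |ξ|)^((pₓ - 2)/2) ξ`. -/
def Fmap (N n : ℕ) (px κ : ℝ) (ξ : EuclideanSpace ℝ (Fin N × Fin n)) :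
    EuclideanSpace ℝ (Fin N × Fin n) :=
  ((κ + ‖ξ‖) ^ ((px - 2) / 2)) • ξ

/-- The shifted function `φ_a(x,t) = ∫₀ᵗ (φ'(x, a+τ)/(a+τ)) τ dτ` associated to
`φ(x,t) = ∫₀ᵗ (κ+s)^(pₓ-2) s ds`, i.e. with `φ'(x,s) = (κ+s)^(pₓ-2) s`. -/
def phiShiftK (px κ a t : ℝ) : ℝ :=
  ∫ τ in (0:ℝ)..t, (((κ + (a + τ)) ^ (px - 2) * (a + τ)) / (a + τ)) * τ

/-- Two nonnegative quantities are comparable with constant `c`. -/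
def Cmp (c x y : ℝ) : Prop := x ≤ c * y ∧ y ≤ c * x

/-- Weighted difference estimate for real powers. -/
lemma abs_rpow_sub_rpow_mul_le {β b x y : ℝ} (hβ : -1 < β) (hb : 0 ≤ b) (hby : b ≤ y)
    (hyx : y ≤ x) :
    |x ^ β - y ^ β| * b ≤ max 1 β * (x ^ β * (x - y)) ∧
      (β < 0 → |x ^ β - y ^ β| * b ≤ -β * (x ^ β * (x - y))) := by
  rcases hb.eq_or_lt with rfl | hb
  · have h : 0 ≤ x ^ β * (x - y) :=
      mul_nonneg (Real.rpow_nonneg (hby.trans hyx) _) (sub_nonneg.2 hyx)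
    simp only [mul_zero]
    exact ⟨mul_nonneg (le_max_of_le_left zero_le_one) h, fun h' => mul_nonneg (by linarith) h⟩
  have hy : 0 < y := hb.trans_le hby
  have hx : 0 < x := hy.trans_le hyx
  have hu : 0 < x ^ β := Real.rpow_pos_of_pos hx _
  have hneg : β < 0 → |x ^ β - y ^ β| * b ≤ -β * (x ^ β * (x - y)) := by
    intro h
    have hle : x ^ β ≤ y ^ β := Real.rpow_le_rpow_of_nonpos hy hyx h.le
    rw [abs_of_nonpos (by linarith)]
    have h1 : (x / y) ^ (-β) ≤ 1 + -β * ((x - y) / y) := by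
      have := rpow_one_add_le_one_add_mul_self (s := (x - y) / y) (p := -β)
        (by have : 0 ≤ (x - y) / y := div_nonneg (by linarith) hy.le
            linarith) (by linarith) (by linarith)
      have e : 1 + (x - y) / y = x / y := by field_simp; ring
      rwa [e] at this
    have h2 : y ^ β = x ^ β * (x / y) ^ (-β) := by
      rw [Real.div_rpow hx.le hy.le, Real.rpow_neg hx.le, Real.rpow_neg hy.le]
      field_simp
    have h3 : (x - y) / y * b ≤ x - y := by
      rw [div_mul_eq_mul_div, div_le_iff₀ hy]
      exact mul_le_mul_of_nonneg_left hby (by linarith)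
    calc -(x ^ β - y ^ β) * b = x ^ β * (((x / y) ^ (-β) - 1) * b) := by rw [h2]; ring
      _ ≤ x ^ β * ((-β * ((x - y) / y)) * b) := by gcongr; linarith
      _ = -β * (x ^ β * ((x - y) / y * b)) := by ring
      _ ≤ -β * (x ^ β * (x - y)) := by gcongr; linarith
  refine ⟨?_, hneg⟩
  rcases lt_or_ge β 0 with h | h
  · refine (hneg h).trans (mul_le_mul_of_nonneg_right ?_ ?_)
    · exact le_max_of_le_left (by linarith)
    · exact mul_nonneg hu.le (by linarith)
  · have hle : y ^ β ≤ x ^ β := Real.rpow_le_rpow hy.le hyx h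
    rw [abs_of_nonneg (by linarith)]
    have hz1 : y / x ≤ 1 := (div_le_one hx).2 hyx
    have h1 : 1 - (y / x) ^ β ≤ max 1 β * (1 - y / x) := by
      rcases le_total β 1 with h' | h'
      · have := Real.rpow_le_rpow_of_exponent_ge (div_pos hy hx) hz1 h'
        rw [Real.rpow_one] at this
        rw [max_eq_left h']
        linarith
      · have := one_add_mul_self_le_rpow_one_add (s := y / x - 1) (p := β)
          (by have := div_pos hy hx; linarith) h'
        rw [add_sub_cancel] at this
        rw [max_eq_right h']
        linarith
    have h2 : y ^ β = x ^ β * (y / x) ^ β := by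
      rw [Real.div_rpow hy.le hx.le]
      field_simp
    have h3 : (1 - y / x) * b ≤ x - y := by
      have : 1 - y / x = (x - y) / x := by field_simp
      rw [this, div_mul_eq_mul_div, div_le_iff₀ hx]
      exact mul_le_mul_of_nonneg_left (hby.trans hyx) (by linarith)
    calc (x ^ β - y ^ β) * b = x ^ β * ((1 - (y / x) ^ β) * b) := by rw [h2]; ring
      _ ≤ x ^ β * ((max 1 β * (1 - y / x)) * b) := by gcongr
      _ = max 1 β * (x ^ β * ((1 - y / x) * b)) := by ring
      _ ≤ max 1 β * (x ^ β * (x - y)) := by gcongr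

section PowerField

variable {E : Type*} [NormedAddCommGroup E] [InnerProductSpace ℝ E]

/-- Monotonicity of `ξ ↦ (κ + ‖ξ‖) ^ β • ξ`, in terms of the larger of the two norms. -/
lemma inner_rpow_smul_sub_ge {β κ m : ℝ} (hκ : 0 ≤ κ) (hm : 0 < m) (hm1 : m ≤ 1)
    (hmβ : m ≤ 1 + β) {P Q : E} (hPQ : ‖Q‖ ≤ ‖P‖) :
    m / 2 * ((κ + ‖P‖) ^ β * ‖P - Q‖ ^ 2) ≤
      ⟪(κ + ‖P‖) ^ β • P - (κ + ‖Q‖) ^ β • Q, P - Q⟫ := by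
  obtain ⟨-, hK⟩ := abs_rpow_sub_rpow_mul_le (β := β) (b := ‖Q‖) (x := κ + ‖P‖) (y := κ + ‖Q‖)
    (by linarith) (norm_nonneg _) (by linarith) (by linarith)
  have hu : 0 ≤ (κ + ‖P‖) ^ β := Real.rpow_nonneg (by positivity) _
  have hv : 0 ≤ (κ + ‖Q‖) ^ β := Real.rpow_nonneg (by positivity) _
  have hmono : 0 ≤ β → (κ + ‖Q‖) ^ β ≤ (κ + ‖P‖) ^ β := fun h =>
    Real.rpow_le_rpow (by positivity) (by linarith) h
  generalize (κ + ‖P‖) ^ β = u at *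
  generalize (κ + ‖Q‖) ^ β = v at *
  have hrad : m * (u * (‖P‖ - ‖Q‖)) ≤ u * ‖P‖ - v * ‖Q‖ := by
    have hn : 0 ≤ u * (‖P‖ - ‖Q‖) := mul_nonneg hu (by linarith)
    rcases lt_or_ge β 0 with h | h
    · have h1 := hK h
      have h2 : (v - u) * ‖Q‖ ≤ |u - v| * ‖Q‖ := by
        gcongr
        rw [abs_sub_comm]
        exact le_abs_self _
      nlinarith
    · have := mul_le_mul_of_nonneg_right (hmono h) (norm_nonneg Q)
      nlinarith
  have hw : ⟪P, Q⟫ ≤ ‖P‖ * ‖Q‖ := real_inner_le_norm P Q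
  have hin : ⟪u • P - v • Q, P - Q⟫ =
      (u * ‖P‖ - v * ‖Q‖) * (‖P‖ - ‖Q‖) + (u + v) * (‖P‖ * ‖Q‖ - ⟪P, Q⟫) := by
    simp only [inner_sub_left, inner_sub_right, real_inner_smul_left, real_inner_self_eq_norm_sq,
      real_inner_comm P Q]
    ring
  have ht : ‖P - Q‖ ^ 2 = (‖P‖ - ‖Q‖) ^ 2 + 2 * (‖P‖ * ‖Q‖ - ⟪P, Q⟫) := by
    rw [norm_sub_sq_real]; ring
  rw [hin, ht]
  have h1 := mul_le_mul_of_nonneg_right hrad (sub_nonneg.2 hPQ)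
  have h2 : m * u * (‖P‖ * ‖Q‖ - ⟪P, Q⟫) ≤ (u + v) * (‖P‖ * ‖Q‖ - ⟪P, Q⟫) := by
    refine mul_le_mul_of_nonneg_right ?_ (sub_nonneg.2 hw)
    nlinarith
  have h3 : 0 ≤ m * u * (‖P‖ - ‖Q‖) ^ 2 := by positivity
  linarith

/-- Growth of `ξ ↦ (κ + ‖ξ‖) ^ β • ξ`, in terms of the larger of the two norms. -/
lemma norm_rpow_smul_sub_le {β κ B : ℝ} (hκ : 0 ≤ κ) (hβ : -1 < β) (hβB : β ≤ B) (hB : 1 ≤ B)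
    {P Q : E} (hPQ : ‖Q‖ ≤ ‖P‖) :
    ‖(κ + ‖P‖) ^ β • P - (κ + ‖Q‖) ^ β • Q‖ ≤ (1 + B) * ((κ + ‖P‖) ^ β * ‖P - Q‖) := by
  obtain ⟨hK, -⟩ := abs_rpow_sub_rpow_mul_le (β := β) (b := ‖Q‖) (x := κ + ‖P‖) (y := κ + ‖Q‖)
    hβ (norm_nonneg _) (by linarith) (by linarith)
  have hu : 0 ≤ (κ + ‖P‖) ^ β := Real.rpow_nonneg (by positivity) _
  generalize (κ + ‖P‖) ^ β = u at *
  generalize (κ + ‖Q‖) ^ β = v at *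
  have he : u • P - v • Q = u • (P - Q) + (u - v) • Q := by module
  rw [he]
  calc ‖u • (P - Q) + (u - v) • Q‖ ≤ ‖u • (P - Q)‖ + ‖(u - v) • Q‖ := norm_add_le _ _
    _ = u * ‖P - Q‖ + |u - v| * ‖Q‖ := by
      rw [norm_smul, norm_smul, Real.norm_eq_abs, Real.norm_eq_abs, abs_of_nonneg hu]
    _ ≤ u * ‖P - Q‖ + max 1 β * (u * (κ + ‖P‖ - (κ + ‖Q‖))) := by gcongr
    _ ≤ u * ‖P - Q‖ + B * (u * ‖P - Q‖) := by
      have h1 : κ + ‖P‖ - (κ + ‖Q‖) ≤ ‖P - Q‖ := by linarith [norm_sub_norm_le P Q]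
      have h2 : max 1 β ≤ B := max_le hB hβB
      have h3 : 0 ≤ κ + ‖P‖ - (κ + ‖Q‖) := by linarith
      gcongr
    _ = (1 + B) * (u * ‖P - Q‖) := by ring

end PowerField

/-- Real powers of two numbers within a factor `3` of each other are comparable. -/
lemma rpow_le_three_rpow_mul_rpow {β B X Y : ℝ} (hβ : |β| ≤ B) (hX : 0 < X)
    (hY : 0 < Y) (hXY : X ≤ 3 * Y) (hYX : Y ≤ 3 * X) : X ^ β ≤ 3 ^ B * Y ^ β := by
  rcases le_total 0 β with h | h
  · calc X ^ β ≤ (3 * Y) ^ β := Real.rpow_le_rpow hX.le hXY h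
      _ = 3 ^ β * Y ^ β := Real.mul_rpow (by norm_num) hY.le
      _ ≤ 3 ^ B * Y ^ β := by
        gcongr
        · norm_num
        · exact (le_abs_self β).trans hβ
  · calc X ^ β ≤ (Y / 3) ^ β := Real.rpow_le_rpow_of_nonpos (by positivity) (by linarith) h
      _ = 3 ^ (-β) * Y ^ β := by
        rw [Real.div_rpow hY.le (by norm_num), Real.rpow_neg (by norm_num)]
        field_simp
      _ ≤ 3 ^ B * Y ^ β := by
        gcongr
        · norm_num
        · exact (neg_le_abs β).trans hβ

section PowerField

variable {E : Type*} [NormedAddCommGroup E] [InnerProductSpace ℝ E]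

/-- Two-sided bounds for `ξ ↦ (κ + ‖ξ‖) ^ β • ξ` in terms of the shifted quantity
`κ + ‖P‖ + ‖P - Q‖`. -/
lemma rpow_smul_sub_bounds {β κ m B : ℝ} (hκ : 0 ≤ κ) (hm : 0 < m) (hm1 : m ≤ 1)
    (hmβ : m ≤ 1 + β) (hβB : |β| ≤ B) (hB : 1 ≤ B) (P Q : E) :
    m / 2 / 3 ^ B * ((κ + ‖P‖ + ‖P - Q‖) ^ β * ‖P - Q‖ ^ 2) ≤
        ⟪(κ + ‖P‖) ^ β • P - (κ + ‖Q‖) ^ β • Q, P - Q⟫ ∧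
      ‖(κ + ‖P‖) ^ β • P - (κ + ‖Q‖) ^ β • Q‖ ≤
        (1 + B) * 3 ^ B * ((κ + ‖P‖ + ‖P - Q‖) ^ β * ‖P - Q‖) := by
  rcases eq_or_ne P Q with rfl | hne
  · simp
  have ht : 0 < ‖P - Q‖ := norm_pos_iff.2 (sub_ne_zero.2 hne)
  have hP := norm_nonneg P
  have hQ := norm_nonneg Q
  have hQP : ‖Q‖ ≤ ‖P‖ + ‖P - Q‖ := by
    have := norm_sub_norm_le Q P
    rw [norm_sub_rev] at this
    linarith
  have htri : ‖P - Q‖ ≤ ‖P‖ + ‖Q‖ := norm_sub_le P Q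
  obtain ⟨X, hX, hX1, hX2, hlow, hup⟩ : ∃ X : ℝ, 0 < X ∧ X ≤ κ + ‖P‖ + ‖P - Q‖ ∧
      κ + ‖P‖ + ‖P - Q‖ ≤ 3 * X ∧
      m / 2 * (X ^ β * ‖P - Q‖ ^ 2) ≤
        ⟪(κ + ‖P‖) ^ β • P - (κ + ‖Q‖) ^ β • Q, P - Q⟫ ∧
      ‖(κ + ‖P‖) ^ β • P - (κ + ‖Q‖) ^ β • Q‖ ≤ (1 + B) * (X ^ β * ‖P - Q‖) := by
    rcases le_total ‖Q‖ ‖P‖ with h | h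
    · exact ⟨κ + ‖P‖, by linarith, by linarith, by linarith,
        inner_rpow_smul_sub_ge hκ hm hm1 hmβ h,
        norm_rpow_smul_sub_le hκ (by linarith) ((le_abs_self β).trans hβB) hB h⟩
    · refine ⟨κ + ‖Q‖, by linarith, by linarith, by linarith, ?_, ?_⟩
      · have := inner_rpow_smul_sub_ge hκ hm hm1 hmβ h
        rwa [norm_sub_rev, ← inner_neg_neg, neg_sub, neg_sub] at this
      · have := norm_rpow_smul_sub_le hκ (by linarith) ((le_abs_self β).trans hβB) hB h
        rwa [norm_sub_rev, norm_sub_rev Q P] at this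
  have hS : 0 < κ + ‖P‖ + ‖P - Q‖ := by positivity
  generalize κ + ‖P‖ + ‖P - Q‖ = S at *
  have h1 : S ^ β ≤ 3 ^ B * X ^ β :=
    rpow_le_three_rpow_mul_rpow hβB hS hX hX2 (by linarith)
  have h2 : X ^ β ≤ 3 ^ B * S ^ β :=
    rpow_le_three_rpow_mul_rpow hβB hX hS (by linarith) hX2
  constructor
  · refine le_trans ?_ hlow
    calc m / 2 / 3 ^ B * (S ^ β * ‖P - Q‖ ^ 2)
        ≤ m / 2 / 3 ^ B * (3 ^ B * X ^ β * ‖P - Q‖ ^ 2) := by gcongr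
      _ = m / 2 * (X ^ β * ‖P - Q‖ ^ 2) := by field_simp
  · refine hup.trans ?_
    calc (1 + B) * (X ^ β * ‖P - Q‖) ≤ (1 + B) * (3 ^ B * S ^ β * ‖P - Q‖) := by gcongr
      _ = (1 + B) * 3 ^ B * (S ^ β * ‖P - Q‖) := by ring

end PowerField

/-- Two-sided bounds for `∫₀ᵗ (q + τ) ^ α τ dτ`. -/
lemma integral_add_rpow_mul_bounds {α B q t : ℝ} (hα : -1 < α) (hαB : α ≤ B) (hB : 0 ≤ B)
    (hq : 0 ≤ q) (ht : 0 < t) :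
    1 / (2 + B) * ((q + t) ^ α * t ^ 2) ≤ ∫ τ in (0:ℝ)..t, (q + τ) ^ α * τ ∧
      ∫ τ in (0:ℝ)..t, (q + τ) ^ α * τ ≤ (q + t) ^ α * t ^ 2 := by
  have hS : 0 < (q + t) ^ α := Real.rpow_pos_of_pos (by positivity) _
  have hpow : IntervalIntegrable (fun τ : ℝ => (q + t) ^ α * t ^ (-α) * τ ^ (1 + α))
      MeasureTheory.volume 0 t :=
    (intervalIntegral.intervalIntegrable_rpow' (by linarith)).const_mul _
  have hlin : IntervalIntegrable (fun τ : ℝ => (q + t) ^ α * τ) MeasureTheory.volume 0 t :=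
    (continuous_const.mul continuous_id).intervalIntegrable _ _
  have hpowI : ∫ τ in (0:ℝ)..t, (q + t) ^ α * t ^ (-α) * τ ^ (1 + α) =
      1 / (2 + α) * ((q + t) ^ α * t ^ 2) := by
    rw [intervalIntegral.integral_const_mul, integral_rpow (Or.inl (by linarith)),
      Real.zero_rpow (by linarith)]
    have : t ^ (-α) * t ^ (1 + α + 1) = t ^ 2 := by
      rw [← Real.rpow_add ht, ← Real.rpow_natCast]
      congr 1
      push_cast
      ring
    rw [← this]
    have : 2 + α ≠ 0 := by linarith
    have : 1 + α + 1 ≠ 0 := by linarith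
    field_simp
    ring
  have hlinI : ∫ τ in (0:ℝ)..t, (q + t) ^ α * τ = 1 / 2 * ((q + t) ^ α * t ^ 2) := by
    rw [intervalIntegral.integral_const_mul, integral_id]
    ring
  have hscale : ∀ τ ∈ Ioc 0 t, (q + t) ^ α * t ^ (-α) * τ ^ (1 + α) =
      ((q + t) * (τ / t)) ^ α * τ := by
    intro τ hτ
    rw [Real.mul_rpow (by positivity) (div_nonneg hτ.1.le ht.le), Real.div_rpow hτ.1.le ht.le,
      Real.rpow_neg ht.le, Real.rpow_add hτ.1, Real.rpow_one]
    ring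
  have hle1 : ∀ τ ∈ Ioc 0 t, (q + t) * (τ / t) ≤ q + τ := by
    intro τ hτ
    have h1 : τ / t ≤ 1 := (div_le_one ht).2 hτ.2
    have h2 : t * (τ / t) = τ := by field_simp
    nlinarith
  have hmeas : MeasureTheory.AEStronglyMeasurable (fun τ : ℝ => (q + τ) ^ α * τ)
      (MeasureTheory.volume.restrict (uIoc 0 t)) := by
    have : Measurable (fun τ : ℝ => (q + τ) ^ α * τ) := by fun_prop
    exact this.aestronglyMeasurable
  have hint : ∀ h : ℝ → ℝ, IntervalIntegrable h MeasureTheory.volume 0 t →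
      (∀ τ ∈ Ioc 0 t, (q + τ) ^ α * τ ≤ h τ) →
      IntervalIntegrable (fun τ : ℝ => (q + τ) ^ α * τ) MeasureTheory.volume 0 t := by
    intro h hh hle
    refine hh.mono_fun hmeas ?_
    filter_upwards [MeasureTheory.ae_restrict_mem measurableSet_uIoc] with τ hτ
    rw [uIoc_of_le ht.le] at hτ
    have h0 : 0 ≤ (q + τ) ^ α * τ :=
      mul_nonneg (Real.rpow_nonneg (by linarith [hτ.1]) _) hτ.1.le
    rw [Real.norm_of_nonneg h0]
    exact (hle τ hτ).trans (Real.le_norm_self _)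
  have hG : 0 ≤ (q + t) ^ α * t ^ 2 := by positivity
  have hc : ∀ {a : ℝ}, 0 < a → a ≤ 2 + B →
      1 / (2 + B) * ((q + t) ^ α * t ^ 2) ≤ 1 / a * ((q + t) ^ α * t ^ 2) := fun ha hab =>
    mul_le_mul_of_nonneg_right (one_div_le_one_div_of_le ha hab) hG
  have hc' : ∀ {a : ℝ}, 1 ≤ a → 1 / a * ((q + t) ^ α * t ^ 2) ≤ (q + t) ^ α * t ^ 2 := fun ha =>
    mul_le_of_le_one_left hG ((div_le_one (by linarith)).2 ha)
  rcases le_total 0 α with h | h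
  · have hupper : ∀ τ ∈ Ioc 0 t, (q + τ) ^ α * τ ≤ (q + t) ^ α * τ := fun τ hτ =>
      mul_le_mul_of_nonneg_right
        (Real.rpow_le_rpow (by linarith [hτ.1]) (by linarith [hτ.2]) h) hτ.1.le
    have hlower : ∀ τ ∈ Ioc 0 t,
        (q + t) ^ α * t ^ (-α) * τ ^ (1 + α) ≤ (q + τ) ^ α * τ := by
      intro τ hτ
      rw [hscale τ hτ]
      exact mul_le_mul_of_nonneg_right
        (Real.rpow_le_rpow (mul_nonneg (by positivity) (div_nonneg hτ.1.le ht.le))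
          (hle1 τ hτ) h) hτ.1.le
    have hi := hint _ hlin hupper
    constructor
    · refine (hc (a := 2 + α) (by linarith) (by linarith)).trans ?_
      rw [← hpowI]
      exact intervalIntegral.integral_mono_on_of_le_Ioo ht.le hpow hi
        fun τ hτ => hlower τ (Ioo_subset_Ioc_self hτ)
    · refine le_trans ?_ (hc' (a := 2) (by norm_num))
      rw [← hlinI]
      exact intervalIntegral.integral_mono_on_of_le_Ioo ht.le hi hlin
        fun τ hτ => hupper τ (Ioo_subset_Ioc_self hτ)
  · have hlower : ∀ τ ∈ Ioc 0 t, (q + t) ^ α * τ ≤ (q + τ) ^ α * τ := fun τ hτ =>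
      mul_le_mul_of_nonneg_right
        (Real.rpow_le_rpow_of_nonpos (by linarith [hτ.1]) (by linarith [hτ.2]) h) hτ.1.le
    have hupper : ∀ τ ∈ Ioc 0 t,
        (q + τ) ^ α * τ ≤ (q + t) ^ α * t ^ (-α) * τ ^ (1 + α) := by
      intro τ hτ
      rw [hscale τ hτ]
      exact mul_le_mul_of_nonneg_right
        (Real.rpow_le_rpow_of_nonpos (mul_pos (by positivity) (div_pos hτ.1 ht))
          (hle1 τ hτ) h) hτ.1.le
    have hi := hint _ hpow hupper
    constructor
    · refine (hc (a := 2) (by norm_num) (by linarith)).trans ?_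
      rw [← hlinI]
      exact intervalIntegral.integral_mono_on_of_le_Ioo ht.le hlin hi
        fun τ hτ => hlower τ (Ioo_subset_Ioc_self hτ)
    · refine le_trans ?_ (hc' (a := 2 + α) (by linarith))
      rw [← hpowI]
      exact intervalIntegral.integral_mono_on_of_le_Ioo ht.le hi hpow
        fun τ hτ => hupper τ (Ioo_subset_Ioc_self hτ)

lemma phiShiftK_eq_integral {px κ a t : ℝ} (ha : 0 ≤ a) (ht : 0 ≤ t) :
    phiShiftK px κ a t = ∫ τ in (0:ℝ)..t, (κ + a + τ) ^ (px - 2) * τ := by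
  unfold phiShiftK
  refine intervalIntegral.integral_congr_ae (Filter.Eventually.of_forall fun τ hτ => ?_)
  rw [uIoc_of_le ht] at hτ
  have : a + τ ≠ 0 := by linarith [hτ.1]
  rw [mul_div_cancel_right₀ _ this, add_assoc]

lemma phiShiftK_bounds {px κ a t B : ℝ} (hp : 1 < px) (hpB : px ≤ B) (hκ : 0 ≤ κ) (ha : 0 ≤ a)
    (ht : 0 ≤ t) :
    1 / (2 + B) * ((κ + a + t) ^ (px - 2) * t ^ 2) ≤ phiShiftK px κ a t ∧
      phiShiftK px κ a t ≤ (κ + a + t) ^ (px - 2) * t ^ 2 := by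
  rw [phiShiftK_eq_integral ha ht]
  rcases ht.eq_or_lt with rfl | ht
  · simp
  · exact integral_add_rpow_mul_bounds (by linarith) (by linarith) (by linarith) (by linarith) ht

/-- Quantities trapped between fixed multiples of a common one are comparable. -/
lemma Cmp.of_bounds {c₁ c₂ G x y : ℝ} (h₁ : 0 < c₁) (h₂ : 0 ≤ c₂)
    (hx : c₁ * G ≤ x ∧ x ≤ c₂ * G) (hy : c₁ * G ≤ y ∧ y ≤ c₂ * G) : Cmp (c₂ / c₁) x y := by
  have key : ∀ {z w : ℝ}, z ≤ c₂ * G → c₁ * G ≤ w → z ≤ c₂ / c₁ * w := fun {z w} hz hw =>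
    calc z ≤ c₂ * G := hz
      _ = c₂ / c₁ * (c₁ * G) := by field_simp
      _ ≤ c₂ / c₁ * w := by gcongr
  exact ⟨key hx.2 hy.1, key hy.2 hx.1⟩

/-- Variable-exponent version of the "hammer" lemma: for `1 < p⁻ ≤ p(x) ≤ p⁺ < ∞` there is
`c ≥ 1` depending only on `p⁻, p⁺` such that for every `κ ∈ [0,1]`, every `x ∈ Ω` and all
`P, Q ∈ ℝ^{N×n}`, the quantities `(A(x,P) - A(x,Q)) : (P - Q)`, `|F(x,P) - F(x,Q)|²` and
`φ_{|P|}(x, |P - Q|)` are pairwise comparable with constant `c`. -/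
theorem hammer_variable (pminus pplus : ℝ) (hpm : 1 < pminus) (hple : pminus ≤ pplus) :
    ∃ c : ℝ, 1 ≤ c ∧
      ∀ κ ∈ Icc (0:ℝ) 1, ∀ (d N n : ℕ) (Ω : Set (Fin d → ℝ)) (p : (Fin d → ℝ) → ℝ),
        (∀ x ∈ Ω, pminus ≤ p x ∧ p x ≤ pplus) →
        ∀ x ∈ Ω, ∀ P Q : EuclideanSpace ℝ (Fin N × Fin n),
          Cmp c ⟪Amap N n (p x) κ P - Amap N n (p x) κ Q, P - Q⟫
              (‖Fmap N n (p x) κ P - Fmap N n (p x) κ Q‖ ^ 2) ∧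
          Cmp c ⟪Amap N n (p x) κ P - Amap N n (p x) κ Q, P - Q⟫
              (phiShiftK (p x) κ ‖P‖ ‖P - Q‖) ∧
          Cmp c (‖Fmap N n (p x) κ P - Fmap N n (p x) κ Q‖ ^ 2)
              (phiShiftK (p x) κ ‖P‖ ‖P - Q‖) := by
  set m : ℝ := min 1 (pminus - 1) with hm_def
  have hm : 0 < m := lt_min one_pos (by linarith)
  have hm1 : m ≤ 1 := min_le_left _ _
  have hmp : m ≤ pminus - 1 := min_le_right _ _
  set l : ℝ := m / 2 / 3 ^ pplus with hl_def
  set U : ℝ := (1 + pplus) * 3 ^ pplus with hU_def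
  have h3 : (1:ℝ) ≤ 3 ^ pplus := Real.one_le_rpow (by norm_num) (by linarith)
  have hl : 0 < l := by positivity
  have hl1 : l ≤ 1 := (div_le_one (by positivity)).2 (by linarith)
  have hU : 1 ≤ U := one_le_mul_of_one_le_of_one_le (by linarith) h3
  have hB : 1 / (2 + pplus) ≤ 1 := (div_le_one (by linarith)).2 (by linarith)
  have hB0 : 0 < 1 / (2 + pplus) := one_div_pos.2 (by linarith)
  have hl2 : l ^ 2 ≤ l := pow_le_of_le_one hl.le hl1 two_ne_zero
  have hU2 : U ≤ U ^ 2 := le_self_pow₀ hU two_ne_zero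
  set c₁ : ℝ := l ^ 2 * (1 / (2 + pplus)) with hc₁_def
  have hc₁ : 0 < c₁ := by positivity
  have hc₁l : c₁ ≤ l ^ 2 := mul_le_of_le_one_right (by positivity) hB
  have hc₁B : c₁ ≤ 1 / (2 + pplus) := mul_le_of_le_one_left hB0.le (by linarith)
  refine ⟨U ^ 2 / c₁, (one_le_div hc₁).2 (by linarith), ?_⟩
  intro κ hκ d N n Ω p hp x hx P Q
  obtain ⟨hp1, hp2⟩ := hp x hx
  have hκ0 : 0 ≤ κ := hκ.1
  obtain ⟨hAl, hAu⟩ := rpow_smul_sub_bounds (β := p x - 2) hκ0 hm hm1 (by linarith)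
    (B := pplus) (abs_le.2 ⟨by linarith, by linarith⟩) (by linarith) P Q
  obtain ⟨hFl, hFu⟩ := rpow_smul_sub_bounds (β := (p x - 2) / 2) hκ0 hm hm1 (by linarith)
    (B := pplus) (abs_le.2 ⟨by linarith, by linarith⟩) (by linarith) P Q
  obtain ⟨hφl, hφu⟩ := phiShiftK_bounds (px := p x) (B := pplus) (by linarith) hp2 hκ0
    (norm_nonneg P) (norm_nonneg (P - Q))
  rw [← hl_def] at hAl hFl
  rw [← hU_def] at hAu hFu
  have hS : 0 ≤ κ + ‖P‖ + ‖P - Q‖ := by positivity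
  have hsq : ((κ + ‖P‖ + ‖P - Q‖) ^ ((p x - 2) / 2)) ^ 2 =
      (κ + ‖P‖ + ‖P - Q‖) ^ (p x - 2) := by
    rw [← Real.rpow_mul_natCast hS]
    congr 1
    push_cast
    ring
  set G : ℝ := (κ + ‖P‖ + ‖P - Q‖) ^ (p x - 2) * ‖P - Q‖ ^ 2 with hG_def
  have hG : 0 ≤ G := mul_nonneg (Real.rpow_nonneg hS _) (sq_nonneg _)
  have hA : c₁ * G ≤ ⟪Amap N n (p x) κ P - Amap N n (p x) κ Q, P - Q⟫ ∧
      ⟪Amap N n (p x) κ P - Amap N n (p x) κ Q, P - Q⟫ ≤ U ^ 2 * G := by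
    unfold Amap
    refine ⟨(mul_le_mul_of_nonneg_right (hc₁l.trans hl2) hG).trans hAl, ?_⟩
    calc _ ≤ _ := real_inner_le_norm _ _
      _ ≤ U * ((κ + ‖P‖ + ‖P - Q‖) ^ (p x - 2) * ‖P - Q‖) * ‖P - Q‖ :=
        mul_le_mul_of_nonneg_right hAu (norm_nonneg _)
      _ = U * G := by rw [hG_def]; ring
      _ ≤ U ^ 2 * G := mul_le_mul_of_nonneg_right hU2 hG
  have hF : c₁ * G ≤ ‖Fmap N n (p x) κ P - Fmap N n (p x) κ Q‖ ^ 2 ∧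
      ‖Fmap N n (p x) κ P - Fmap N n (p x) κ Q‖ ^ 2 ≤ U ^ 2 * G := by
    unfold Fmap
    have hGF : G = ((κ + ‖P‖ + ‖P - Q‖) ^ ((p x - 2) / 2) * ‖P - Q‖) ^ 2 := by
      rw [mul_pow, hsq]
    have hV : 0 ≤ (κ + ‖P‖ + ‖P - Q‖) ^ ((p x - 2) / 2) := Real.rpow_nonneg hS _
    constructor
    · refine (mul_le_mul_of_nonneg_right hc₁l hG).trans ?_
      rw [hGF, ← mul_pow]
      refine pow_le_pow_left₀ (by positivity) ?_ 2
      rcases (norm_nonneg (P - Q)).eq_or_lt with h | h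
      · rw [← h]
        simp
      · refine le_of_mul_le_mul_right ?_ h
        refine le_trans (le_of_eq ?_) (hFl.trans (real_inner_le_norm _ _))
        ring
    · rw [hGF, ← mul_pow]
      exact pow_le_pow_left₀ (norm_nonneg _) hFu 2
  have hφ : c₁ * G ≤ phiShiftK (p x) κ ‖P‖ ‖P - Q‖ ∧
      phiShiftK (p x) κ ‖P‖ ‖P - Q‖ ≤ U ^ 2 * G :=
    ⟨(mul_le_mul_of_nonneg_right hc₁B hG).trans hφl,
      hφu.trans (le_mul_of_one_le_left hG (by linarith))⟩
  have hU0 : 0 ≤ U ^ 2 := sq_nonneg U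
  exact ⟨.of_bounds hc₁ hU0 hA hF, .of_bounds hc₁ hU0 hA hφ, .of_bounds hc₁ hU0 hF hφ⟩
end
end

section
/- Let n, N ∈ ℕ, r ∈ ℕ₀, γ₀ > 0 and j ∈ ℕ₀. Then there exists a constant c, depending only on n, N, r, γ₀ and j, such that for every simplex K ⊂ ℝⁿ (the convex hull of n+1 affinely independent points) whose diameter h_K and inradius ρ_K (the supremum of radii of balls contained in K) satisfy h_K ≤ γ₀ ρ_K, for every function v : ℝⁿ → ℝ^N all of whose components are polynomials of total degree at most r, and for every x ∈ K, one has h_K^j |∇^j v(x)| ≤ c · h_K^j ⨍_K |∇^j v(y)| dy ≤ c ⨍_K |v(y)| dy, where ∇^j v denotes the j-th derivative and |∇^j v| its operator norm. -/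
open MeasureTheory Set

noncomputable section

/-- The simplex spanned by `n+1` points of `ℝⁿ`. -/
def simplexOf (n : ℕ) (v : Fin (n + 1) → (Fin n → ℝ)) : Set (Fin n → ℝ) :=
  convexHull ℝ (Set.range v)

/-- The inradius of a set `K ⊆ ℝⁿ`: the supremum of the radii of balls contained in `K`. -/
def inradiusOf (n : ℕ) (K : Set (Fin n → ℝ)) : ℝ :=
  sSup {r : ℝ | ∃ x₀ : Fin n → ℝ, Metric.ball x₀ r ⊆ K}

/-- The `ℝ^N`-valued polynomial map with components `P k`. -/
def polyMap (n N : ℕ) (P : Fin N → MvPolynomial (Fin n) ℝ) (y : Fin n → ℝ) : Fin N → ℝ :=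
  fun k => MvPolynomial.eval y (P k)

theorem LinearMap.exists_norm_le_of_ker_le {V F₁ F₂ : Type*} [AddCommGroup V] [Module ℝ V]
    [FiniteDimensional ℝ V] [NormedAddCommGroup F₁] [NormedSpace ℝ F₁]
    [NormedAddCommGroup F₂] [NormedSpace ℝ F₂] (A : V →ₗ[ℝ] F₁) (B : V →ₗ[ℝ] F₂)
    (h : ∀ v, A v = 0 → B v = 0) : ∃ C : ℝ, 0 ≤ C ∧ ∀ v, ‖B v‖ ≤ C * ‖A v‖ := by
  obtain ⟨g, hg⟩ := A.rangeRestrict.exists_rightInverse_of_surjective A.range_rangeRestrict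
  let T : A.range →L[ℝ] F₂ := (B ∘ₗ g).toContinuousLinearMap
  refine ⟨‖T‖, T.opNorm_nonneg, fun v => ?_⟩
  have hA : A (v - g (A.rangeRestrict v)) = 0 := by
    have := congrArg Subtype.val (LinearMap.congr_fun hg (A.rangeRestrict v))
    simp only [LinearMap.comp_apply, LinearMap.codRestrict_apply, LinearMap.rangeRestrict,
      LinearMap.id_apply] at this
    rw [map_sub, sub_eq_zero]
    exact this.symm
  have hB : B v = T (A.rangeRestrict v) := by
    have := h _ hA
    rwa [map_sub, sub_eq_zero] at this
  rw [hB]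
  exact T.le_opNorm _

/-- On a finite-dimensional space of continuous functions, the supremum over a compact set of one
linear quantity is controlled by the `L¹` norm of another one over an open set, as soon as the
vanishing of the latter on the open set forces the vanishing of the former. -/
theorem exists_norm_le_setIntegral_norm {X V E F : Type*} [TopologicalSpace X] [MeasurableSpace X]
    [OpensMeasurableSpace X] [SecondCountableTopology X] (μ : Measure X) [μ.IsOpenPosMeasure]
    [IsFiniteMeasureOnCompacts μ]
    [AddCommGroup V] [Module ℝ V] [FiniteDimensional ℝ V]
    [NormedAddCommGroup E] [NormedSpace ℝ E] [NormedAddCommGroup F] [NormedSpace ℝ F]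
    (A : V →ₗ[ℝ] X → E) (B : V →ₗ[ℝ] X → F) (hA : ∀ v, Continuous (A v))
    (hB : ∀ v, Continuous (B v)) {U K : Set X} (hU : IsOpen U) (hK : IsCompact K) (hUK : U ⊆ K)
    (hK' : MeasurableSet K) (hAB : ∀ v, EqOn (A v) 0 U → B v = 0) :
    ∃ C : ℝ, 0 ≤ C ∧ ∀ v, ∀ x ∈ K, ‖B v x‖ ≤ C * ∫ y in U, ‖A v y‖ ∂μ := by
  have hint : ∀ v, Integrable (A v) (μ.restrict U) := fun v =>
    ((hA v).continuousOn.integrableOn_compact' hK hK').mono_set hUK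
  let A' : V →ₗ[ℝ] (X →₁[μ.restrict U] E) :=
    { toFun := fun v => (hint v).toL1 (A v)
      map_add' := fun v w => by
        rw [← Integrable.toL1_add, Integrable.toL1_eq_toL1_iff, map_add]
      map_smul' := fun c v => by
        rw [RingHom.id_apply, ← Integrable.toL1_smul', Integrable.toL1_eq_toL1_iff, map_smul] }
  have : CompactSpace K := isCompact_iff_compactSpace.1 hK
  let B' : V →ₗ[ℝ] C(K, F) :=
    { toFun := fun v => ⟨fun x => B v x, (hB v).comp continuous_subtype_val⟩
      map_add' := fun v w => by ext x; simp
      map_smul' := fun c v => by ext x; simp }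
  obtain ⟨C, hC, h⟩ := A'.exists_norm_le_of_ker_le B' fun v hv => by
    have h0 : A v =ᵐ[μ.restrict U] 0 := by
      rw [← Integrable.toL1_eq_toL1_iff _ _ (hint v) (integrable_zero _ _ _)]
      simpa using! hv
    have := hAB v (Measure.eqOn_open_of_ae_eq h0 hU (hA v).continuousOn continuousOn_const)
    ext x
    simp [B', this]
  refine ⟨C, hC, fun v x hx => ?_⟩
  have hnorm : ‖A' v‖ = ∫ y in U, ‖A v y‖ ∂μ := by
    rw [integral_norm_eq_lintegral_enorm (hint v).aestronglyMeasurable]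
    exact Integrable.norm_toL1_eq_lintegral_enorm _ (hint v)
  rw [← hnorm]
  exact ((B' v).norm_coe_le_norm ⟨x, hx⟩).trans (h v)

theorem MvPolynomial.totalDegree_bind₁_le {σ τ R : Type*} [CommSemiring R]
    (f : σ → MvPolynomial τ R) (hf : ∀ i, (f i).totalDegree ≤ 1) (p : MvPolynomial σ R) :
    (bind₁ f p).totalDegree ≤ p.totalDegree := by
  rw [bind₁, aeval_def, eval₂_eq]
  refine totalDegree_finsetSum_le fun d hd => ?_
  refine (totalDegree_mul _ _).trans ?_
  rw [algebraMap_eq, totalDegree_C, zero_add]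
  refine (totalDegree_finsetProd _ _).trans (le_trans ?_ (le_totalDegree hd))
  refine Finset.sum_le_sum fun i _ => (totalDegree_pow _ _).trans ?_
  simpa using Nat.mul_le_mul_left (d i) (hf i)

theorem analyticOnNhd_polyMap (n N : ℕ) (P : Fin N → MvPolynomial (Fin n) ℝ) :
    AnalyticOnNhd ℝ (polyMap n N P) univ := by
  have h : ∀ k, AnalyticOnNhd ℝ (fun y : Fin n → ℝ => MvPolynomial.eval y (P k)) univ := fun k =>
    AnalyticOnNhd.eval_continuousLinearMap (ContinuousLinearMap.id ℝ (Fin n → ℝ)) (P k)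
  exact AnalyticOnNhd.pi h

theorem contDiff_polyMap (n N : ℕ) {m : WithTop ℕ∞} (P : Fin N → MvPolynomial (Fin n) ℝ) :
    ContDiff ℝ m (polyMap n N P) :=
  (analyticOnNhd_polyMap n N P).contDiff

theorem continuous_iteratedFDeriv_polyMap (n N i : ℕ) (P : Fin N → MvPolynomial (Fin n) ℝ) :
    Continuous (iteratedFDeriv ℝ i (polyMap n N P)) :=
  (contDiff_polyMap n N P).continuous_iteratedFDeriv le_rfl

/-- The `i`-th derivative as a linear map on vector-valued polynomials of degree at most `r`. -/
def polyIteratedFDeriv (n N r i : ℕ) :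
    (Fin N → MvPolynomial.restrictTotalDegree (Fin n) ℝ r) →ₗ[ℝ]
      (Fin n → ℝ) → ((Fin n → ℝ) [×i]→L[ℝ] (Fin N → ℝ)) where
  toFun P := iteratedFDeriv ℝ i (polyMap n N fun k => P k)
  map_add' P Q := by
    rw [← iteratedFDeriv_add (contDiff_polyMap n N _) (contDiff_polyMap n N _)]
    congr 1
    ext y k
    simp [polyMap]
  map_smul' c P := by
    ext1 x
    rw [RingHom.id_apply, Pi.smul_apply,
      ← iteratedFDeriv_const_smul_apply (contDiff_polyMap n N _).contDiffAt]
    congr 1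
    ext y k
    simp [polyMap]

theorem eq_zero_of_iteratedFDeriv_polyMap_eqOn {n N i : ℕ} {P : Fin N → MvPolynomial (Fin n) ℝ}
    {x : Fin n → ℝ} {ε : ℝ} (hε : 0 < ε)
    (h : EqOn (iteratedFDeriv ℝ i (polyMap n N P)) 0 (Metric.ball x ε)) :
    iteratedFDeriv ℝ i (polyMap n N P) = 0 :=
  ((analyticOnNhd_polyMap n N P).iteratedFDeriv i).eq_of_eventuallyEq
    (fun _ _ => analyticAt_const)
    (Filter.eventually_of_mem (Metric.ball_mem_nhds x hε) h)

/-- The inverse estimate on the reference configuration of two concentric balls. -/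
theorem exists_iteratedFDeriv_polyMap_le_setIntegral (n N r i j : ℕ) (hij : i = 0 ∨ i = j)
    {ε : ℝ} (hε : 0 < ε) :
    ∃ C : ℝ, 0 ≤ C ∧ ∀ P : Fin N → MvPolynomial (Fin n) ℝ, (∀ k, (P k).totalDegree ≤ r) →
      ∀ x ∈ Metric.closedBall (0 : Fin n → ℝ) 1, ‖iteratedFDeriv ℝ j (polyMap n N P) x‖ ≤
        C * ∫ y in Metric.ball (0 : Fin n → ℝ) ε, ‖iteratedFDeriv ℝ i (polyMap n N P) y‖ := by
  have hsub : Metric.ball (0 : Fin n → ℝ) ε ⊆ Metric.closedBall 0 (max 1 ε) :=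
    Metric.ball_subset_closedBall.trans (Metric.closedBall_subset_closedBall (le_max_right _ _))
  obtain ⟨C, hC, h⟩ := exists_norm_le_setIntegral_norm volume (polyIteratedFDeriv n N r i)
    (polyIteratedFDeriv n N r j) (fun _ => continuous_iteratedFDeriv_polyMap n N i _)
    (fun _ => continuous_iteratedFDeriv_polyMap n N j _) Metric.isOpen_ball
    (isCompact_closedBall _ _) hsub measurableSet_closedBall fun P hP => by
      have h0 := eq_zero_of_iteratedFDeriv_polyMap_eqOn hε hP
      rcases hij with rfl | rfl
      · have hp : polyMap n N (fun k => (P k : MvPolynomial (Fin n) ℝ)) = 0 := by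
          ext1 x
          rw [Pi.zero_apply, ← norm_eq_zero, ← norm_iteratedFDeriv_zero (𝕜 := ℝ), h0]
          simp
        change iteratedFDeriv ℝ j (polyMap n N _) = 0
        rw [hp, iteratedFDeriv_zero]
      · exact h0
  refine ⟨C, hC, fun P hP x hx => ?_⟩
  exact h (fun k => ⟨P k, (MvPolynomial.mem_restrictTotalDegree _ _ _).2 (hP k)⟩) x
    (Metric.closedBall_subset_closedBall (le_max_left _ _) hx)

theorem exists_polyMap_comp_affine (n N r : ℕ) (P : Fin N → MvPolynomial (Fin n) ℝ)
    (hP : ∀ k, (P k).totalDegree ≤ r) (x₀ : Fin n → ℝ) (h : ℝ) :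
    ∃ Q : Fin N → MvPolynomial (Fin n) ℝ, (∀ k, (Q k).totalDegree ≤ r) ∧
      polyMap n N Q = fun y => polyMap n N P (x₀ + h • y) := by
  let f : Fin n → MvPolynomial (Fin n) ℝ := fun i =>
    MvPolynomial.C (x₀ i) + h • MvPolynomial.X i
  have hf : ∀ i, (f i).totalDegree ≤ 1 := fun i => by
    refine (MvPolynomial.totalDegree_add _ _).trans (max_le (by simp) ?_)
    exact (MvPolynomial.totalDegree_smul_le _ _).trans (MvPolynomial.totalDegree_X i).le
  refine ⟨fun k => MvPolynomial.bind₁ f (P k),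
    fun k => (MvPolynomial.totalDegree_bind₁_le f hf _).trans (hP k), ?_⟩
  ext y k
  change MvPolynomial.eval₂Hom (RingHom.id ℝ) y _ = MvPolynomial.eval₂Hom (RingHom.id ℝ) _ (P k)
  rw [MvPolynomial.eval₂Hom_bind₁]
  congr 2
  ext i
  simp [f]

theorem norm_iteratedFDeriv_comp_affine {E F : Type*} [NormedAddCommGroup E] [NormedSpace ℝ E]
    [NormedAddCommGroup F] [NormedSpace ℝ F] {i : ℕ} {f : E → F} (hf : ContDiff ℝ i f) (x₀ : E)
    {h : ℝ} (hh : 0 ≤ h) (y : E) :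
    ‖iteratedFDeriv ℝ i (fun z => f (x₀ + h • z)) y‖ =
      h ^ i * ‖iteratedFDeriv ℝ i f (x₀ + h • y)‖ := by
  have hg : ContDiff ℝ i fun z => f (x₀ + z) := hf.comp (contDiff_const.add contDiff_id)
  rw [iteratedFDeriv_comp_const_smul h hg, norm_smul, Real.norm_of_nonneg (pow_nonneg hh i),
    iteratedFDeriv_comp_add_left]

theorem setIntegral_ball_comp_affine {n : ℕ} (f : (Fin n → ℝ) → ℝ) (x₀ : Fin n → ℝ) {h : ℝ}
    (hh : 0 < h) (ε : ℝ) :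
    ∫ y in Metric.ball (0 : Fin n → ℝ) ε, f (x₀ + h • y) =
      (h ^ n)⁻¹ * ∫ y in Metric.ball x₀ (h * ε), f y := by
  rw [Measure.setIntegral_comp_smul_of_pos volume (fun z => f (x₀ + z)) _ hh,
    smul_ball hh.ne', smul_zero, Real.norm_of_nonneg hh.le, Module.finrank_fin_fun, smul_eq_mul,
    ← (measurePreserving_add_left volume x₀).setIntegral_preimage_emb
      (measurableEmbedding_addLeft x₀) f, preimage_add_ball, sub_self]

theorem volume_real_le_of_subset_closedBall {n : ℕ} {K : Set (Fin n → ℝ)} {x₀ : Fin n → ℝ} {h : ℝ}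
    (hh : 0 ≤ h) (hK : K ⊆ Metric.closedBall x₀ h) : volume.real K ≤ 2 ^ n * h ^ n := by
  refine (measureReal_mono hK measure_closedBall_lt_top.ne).trans ?_
  rw [measureReal_def, Real.volume_pi_closedBall _ hh, ENNReal.toReal_ofReal (by positivity),
    Fintype.card_fin, mul_pow]

/-- The inverse estimate on sets squeezed between two balls of comparable radii. -/
theorem exists_diam_pow_mul_iteratedFDeriv_le (n N r i j : ℕ) (hij : i = 0 ∨ i = j)
    {ε : ℝ} (hε : 0 < ε) :
    ∃ C : ℝ, 0 ≤ C ∧ ∀ (K : Set (Fin n → ℝ)) (x₀ : Fin n → ℝ) (h : ℝ), 0 < h → IsCompact K →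
      Metric.ball x₀ (h * ε) ⊆ K → K ⊆ Metric.closedBall x₀ h →
      ∀ P : Fin N → MvPolynomial (Fin n) ℝ, (∀ k, (P k).totalDegree ≤ r) → ∀ x ∈ K,
        h ^ j * ‖iteratedFDeriv ℝ j (polyMap n N P) x‖ ≤
          C * (h ^ i * ⨍ y in K, ‖iteratedFDeriv ℝ i (polyMap n N P) y‖) := by
  obtain ⟨C, hC, hmain⟩ := exists_iteratedFDeriv_polyMap_le_setIntegral n N r i j hij hε
  refine ⟨C * 2 ^ n, by positivity, fun K x₀ h hh hK hb hcb P hP x hx => ?_⟩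
  obtain ⟨Q, hQ, hQP⟩ := exists_polyMap_comp_affine n N r P hP x₀ h
  have hy : h⁻¹ • (x - x₀) ∈ Metric.closedBall (0 : Fin n → ℝ) 1 := by
    have := mem_closedBall_iff_norm.1 (hcb hx)
    rw [mem_closedBall_zero_iff, norm_smul, Real.norm_of_nonneg (by positivity),
      inv_mul_le_one₀ hh]
    exact this
  have key := hmain Q hQ _ hy
  simp only [hQP, norm_iteratedFDeriv_comp_affine (contDiff_polyMap n N P) x₀ hh.le] at key
  rw [smul_inv_smul₀ hh.ne', add_sub_cancel, integral_const_mul,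
    setIntegral_ball_comp_affine (fun z => ‖iteratedFDeriv ℝ i (polyMap n N P) z‖) x₀ hh] at key
  refine key.trans ?_
  have hint : IntegrableOn (fun z => ‖iteratedFDeriv ℝ i (polyMap n N P) z‖) K :=
    (continuous_iteratedFDeriv_polyMap n N i P).norm.continuousOn.integrableOn_compact hK
  have hmono : ∫ y in Metric.ball x₀ (h * ε), ‖iteratedFDeriv ℝ i (polyMap n N P) y‖ ≤
      ∫ y in K, ‖iteratedFDeriv ℝ i (polyMap n N P) y‖ :=
    setIntegral_mono_set hint (ae_of_all _ fun _ => norm_nonneg _) hb.eventuallyLE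
  have hvol_pos : 0 < volume.real K := by
    refine (ENNReal.toReal_pos (Metric.measure_ball_pos volume x₀ (mul_pos hh hε)).ne'
      measure_ball_lt_top.ne).trans_le (measureReal_mono hb hK.measure_ne_top)
  have hvol : (h ^ n)⁻¹ ≤ 2 ^ n * (volume.real K)⁻¹ := by
    have := volume_real_le_of_subset_closedBall hh.le hcb
    rw [← div_eq_mul_inv, le_div_iff₀ hvol_pos, inv_mul_le_iff₀ (by positivity)]
    linarith
  rw [setAverage_eq, smul_eq_mul]
  calc C * (h ^ i * ((h ^ n)⁻¹ *
        ∫ y in Metric.ball x₀ (h * ε), ‖iteratedFDeriv ℝ i (polyMap n N P) y‖))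
      ≤ C * (h ^ i * ((2 ^ n * (volume.real K)⁻¹) *
        ∫ y in K, ‖iteratedFDeriv ℝ i (polyMap n N P) y‖)) := by gcongr
    _ = _ := by ring

theorem setAverage_le_of_forall_le {X : Type*} [MeasurableSpace X] {μ : Measure X} {K : Set X}
    {f : X → ℝ} {M : ℝ} (hμ : μ K ≠ ⊤) (hM : 0 ≤ M) (h0 : ∀ x, 0 ≤ f x) (h : ∀ x ∈ K, f x ≤ M) :
    ⨍ x in K, f x ∂μ ≤ M := by
  have := norm_setIntegral_le_of_norm_le_const (f := f) (lt_top_iff_ne_top.2 hμ)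
    fun x hx => (Real.norm_of_nonneg (h0 x)).trans_le (h x hx)
  rw [setAverage_eq, smul_eq_mul]
  refine inv_mul_le_of_le_mul₀ measureReal_nonneg hM ?_
  rw [mul_comm]
  exact (Real.le_norm_self _).trans this

theorem isCompact_simplexOf (n : ℕ) (v : Fin (n + 1) → (Fin n → ℝ)) :
    IsCompact (simplexOf n v) :=
  (Set.finite_range v).isCompact_convexHull ℝ

theorem diam_simplexOf_pos {n : ℕ} (hn : n ≠ 0) {v : Fin (n + 1) → (Fin n → ℝ)}
    (hv : AffineIndependent ℝ v) : 0 < Metric.diam (simplexOf n v) := by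
  have hmem : ∀ i, v i ∈ simplexOf n v := fun i => subset_convexHull ℝ _ (mem_range_self i)
  have hne : (0 : Fin (n + 1)) ≠ Fin.last n := by
    simpa [Fin.ext_iff] using hn.symm
  exact (dist_pos.2 (hv.injective.ne hne)).trans_le
    (Metric.dist_le_diam_of_mem (isCompact_simplexOf n v).isBounded (hmem _) (hmem _))

theorem exists_ball_subset_of_lt_inradiusOf {n : ℕ} {K : Set (Fin n → ℝ)} {s : ℝ} (hs : 0 < s)
    (h : s < inradiusOf n K) : ∃ x₀, Metric.ball x₀ s ⊆ K := by
  have hne : {r : ℝ | ∃ x₀ : Fin n → ℝ, Metric.ball x₀ r ⊆ K}.Nonempty := by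
    by_contra hempty
    rw [inradiusOf, Set.not_nonempty_iff_eq_empty.1 hempty, Real.sSup_empty] at h
    exact hs.not_gt h
  obtain ⟨t, ⟨x₀, hx₀⟩, ht⟩ := exists_lt_of_lt_csSup hne h
  exact ⟨x₀, (Metric.ball_subset_ball ht.le).trans hx₀⟩

theorem setAverage_of_subsingleton {X : Type*} [Subsingleton X] [MeasurableSpace X] {μ : Measure X}
    {K : Set X} (f : X → ℝ) (x : X) (h0 : μ K ≠ 0) (hK : μ K ≠ ⊤) : ⨍ y in K, f y ∂μ = f x := by
  rw [show f = fun _ => f x from funext fun y => congrArg f (Subsingleton.elim y x)]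
  exact setAverage_const h0 hK _

/-- Inverse estimate for polynomials on non-degenerate simplices: for all `n, N, r, γ₀, j`
there is `c = c(n, N, r, γ₀, j)` such that for every simplex `K` with `h_K ≤ γ₀ ρ_K`, every
`v : ℝⁿ → ℝ^N` with polynomial components of total degree at most `r`, and every `x ∈ K`,
`h_K^j |∇^j v(x)| ≤ c h_K^j ⨍_K |∇^j v| ≤ c² ⨍_K |v|` (stated as the two inequalities
`h_K^j |∇^j v(x)| ≤ c (h_K^j ⨍_K |∇^j v|)` and `h_K^j ⨍_K |∇^j v| ≤ c ⨍_K |v|`). -/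
theorem inverse_estimate (n N r j : ℕ) (γ₀ : ℝ) (hγ₀ : 0 < γ₀) :
    ∃ c : ℝ, 0 < c ∧
      ∀ v : Fin (n + 1) → (Fin n → ℝ), AffineIndependent ℝ v →
        Metric.diam (simplexOf n v) ≤ γ₀ * inradiusOf n (simplexOf n v) →
        ∀ P : Fin N → MvPolynomial (Fin n) ℝ, (∀ k, (P k).totalDegree ≤ r) →
          ∀ x ∈ simplexOf n v,
            Metric.diam (simplexOf n v) ^ j *
                ‖iteratedFDeriv ℝ j (polyMap n N P) x‖ ≤
              c * (Metric.diam (simplexOf n v) ^ j *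
                ⨍ y in simplexOf n v, ‖iteratedFDeriv ℝ j (polyMap n N P) y‖) ∧
            Metric.diam (simplexOf n v) ^ j *
                (⨍ y in simplexOf n v, ‖iteratedFDeriv ℝ j (polyMap n N P) y‖) ≤
              c * ⨍ y in simplexOf n v, ‖polyMap n N P y‖ := by
  obtain ⟨C₁, hC₁, h₁⟩ := exists_diam_pow_mul_iteratedFDeriv_le n N r j j (Or.inr rfl)
    (ε := (2 * γ₀)⁻¹) (by positivity)
  obtain ⟨C₂, hC₂, h₂⟩ := exists_diam_pow_mul_iteratedFDeriv_le n N r 0 j (Or.inl rfl)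
    (ε := (2 * γ₀)⁻¹) (by positivity)
  refine ⟨C₁ + C₂ + 1, by positivity, fun v hv hγ P hP x hx => ?_⟩
  set K := simplexOf n v
  have hK : IsCompact K := isCompact_simplexOf n v
  have havg : ∀ f : (Fin n → ℝ) → ℝ, (∀ y, 0 ≤ f y) → 0 ≤ ⨍ y in K, f y := fun f hf => by
    rw [setAverage_eq]
    exact smul_nonneg (inv_nonneg.2 measureReal_nonneg) (integral_nonneg hf)
  have hj := havg (fun y => ‖iteratedFDeriv ℝ j (polyMap n N P) y‖) fun _ => norm_nonneg _
  have h0 := havg (fun y => ‖polyMap n N P y‖) fun _ => norm_nonneg _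
  rcases eq_or_ne n 0 with rfl | hn
  · have hKu : K = univ := Subsingleton.eq_univ_of_nonempty ⟨x, hx⟩
    have hvol : volume K ≠ 0 := by
      rw [hKu]; exact isOpen_univ.measure_ne_zero volume univ_nonempty
    rw [setAverage_of_subsingleton _ x hvol hK.measure_ne_top] at hj h0 ⊢
    rw [setAverage_of_subsingleton (fun y => ‖polyMap 0 N P y‖) x hvol hK.measure_ne_top]
    rw [Metric.diam_subsingleton K.subsingleton_of_subsingleton]
    rcases eq_or_ne j 0 with rfl | hj0
    · simp only [pow_zero, one_mul, norm_iteratedFDeriv_zero]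
      constructor <;> nlinarith
    · simp only [zero_pow hj0, zero_mul, mul_zero, le_refl, true_and]
      positivity
  have hh : 0 < Metric.diam K := diam_simplexOf_pos hn hv
  have hρ : 0 < inradiusOf n K := pos_of_mul_pos_right (hh.trans_le hγ) hγ₀.le
  obtain ⟨x₀, hb⟩ := exists_ball_subset_of_lt_inradiusOf (n := n) (K := K)
    (s := Metric.diam K * (2 * γ₀)⁻¹) (by positivity) (by
      rw [← div_eq_mul_inv, div_lt_iff₀ (by positivity)]
      nlinarith [mul_pos hγ₀ hρ])
  have hcb : K ⊆ Metric.closedBall x₀ (Metric.diam K) := fun y hy =>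
    Metric.dist_le_diam_of_mem hK.isBounded hy
      (hb (Metric.mem_ball_self (by positivity)))
  constructor
  · refine (h₁ K x₀ _ hh hK hb hcb P hP x hx).trans ?_
    gcongr
    linarith
  · have hsup : ∀ y ∈ K, Metric.diam K ^ j * ‖iteratedFDeriv ℝ j (polyMap n N P) y‖ ≤
        C₂ * ⨍ y in K, ‖polyMap n N P y‖ := fun y hy => by
      simpa only [pow_zero, one_mul, norm_iteratedFDeriv_zero] using
        h₂ K x₀ _ hh hK hb hcb P hP y hy
    have hle : ⨍ y in K, ‖iteratedFDeriv ℝ j (polyMap n N P) y‖ ≤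
        (C₂ * ⨍ y in K, ‖polyMap n N P y‖) / Metric.diam K ^ j :=
      setAverage_le_of_forall_le hK.measure_ne_top (by positivity) (fun _ => norm_nonneg _)
        fun y hy => (le_div_iff₀' (by positivity)).2 (hsup y hy)
    rw [le_div_iff₀' (by positivity)] at hle
    refine hle.trans ?_
    gcongr
    linarith
end
end
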